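/- arXiv:1808.08679 — 2 statements merged into one kernel-verified Lean document; each statement's English description precedes it below -/
import Mathlib

section
/- For all nonnegative integer vectors μ = (μ_1,…,μ_m) and ν = (ν_1,…,ν_n) with common sum d, the number of m×n matrices with entries in {0,1} whose i-th row sums to μ_i and whose j-th column sums to ν_j equals the sum, over all partitions λ of d, of |Tab(λ',ν)| · |Tab(λ,μ)|, where λ' denotes the conjugate partition of λ (λ'_i = #{j : λ_j ≥ i}). -/
/-- The weight of a semistandard Young tableau: `ssytWeight T i` is the number of cells of the
tableau whose entry equals `i`. -/
def ssytWeight {μ : YoungDiagram} (T : SemistandardYoungTableau μ) (i : ℕ) : ℕ :=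
  (μ.cells.filter fun c => T c.1 c.2 = i).card

/-- `tabCard μ ν` is the number of semistandard Young tableaux of shape `μ` and weight `ν`,
where `ν : Fin n → ℕ`: the entry `j` (for `j < n`) occurs exactly `ν j` times, and no entry
`≥ n` occurs. -/
noncomputable def tabCard (μ : YoungDiagram) {n : ℕ} (ν : Fin n → ℕ) : ℕ :=
  Set.ncard {T : SemistandardYoungTableau μ |
    ∀ j : ℕ, ssytWeight T j = if h : j < n then ν ⟨j, h⟩ else 0}

/-- The Schur polynomial `s_μ(x_0, …, x_{n-1})`, as the generating function of semistandard
Young tableaux of shape `μ` with entries in `{0, …, n-1}`. -/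
noncomputable def schurPoly (n : ℕ) (μ : YoungDiagram) : MvPolynomial (Fin n) ℤ :=
  ∑ᶠ (T : SemistandardYoungTableau μ) (_ : ∀ c ∈ μ.cells, T c.1 c.2 < n),
    ∏ i : Fin n, (MvPolynomial.X i : MvPolynomial (Fin n) ℤ) ^ ssytWeight T (i : ℕ)

/-- The number of odd rows (odd parts) of a Young diagram. -/
def oddRowsCount (lam : YoungDiagram) : ℕ :=
  lam.rowLens.countP fun r => r % 2 = 1

/-- The number of odd columns of a Young diagram. -/
def oddColsCount (lam : YoungDiagram) : ℕ :=
  oddRowsCount lam.transpose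

/-- A Young diagram is a *threshold* partition if its Frobenius coordinates satisfy
`β i = α i + 1` for each `i` up to the Durfee rank; with 0-indexed diagrams this says that
`colLen i = rowLen i + 1` for each diagonal cell `(i, i)`. -/
def YoungDiagram.IsThreshold (lam : YoungDiagram) : Prop :=
  ∀ i : ℕ, (i, i) ∈ lam → lam.colLen i = lam.rowLen i + 1

open Finset

namespace YoungDiagram

/-- The skew diagram `lam / tau` is a horizontal strip: it has at most one cell in each column. -/
def IsHorizontalStrip (tau lam : YoungDiagram) : Prop :=
  tau ≤ lam ∧ ∀ i j, (i + 1, j) ∈ lam → (i, j) ∈ tau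

/-- The skew diagram `lam / tau` is a vertical strip: it has at most one cell in each row. -/
def IsVerticalStrip (tau lam : YoungDiagram) : Prop :=
  tau ≤ lam ∧ ∀ i j, (i, j + 1) ∈ lam → (i, j) ∈ tau

theorem isHorizontalStrip_transpose {tau lam : YoungDiagram} :
    IsHorizontalStrip tau.transpose lam.transpose ↔ IsVerticalStrip tau lam := by
  simp only [IsHorizontalStrip, IsVerticalStrip, transpose_le_iff, mem_transpose, Prod.swap]
  exact and_congr_right fun _ => ⟨fun h i j => h j i, fun h i j => h j i⟩

theorem card_transpose (lam : YoungDiagram) : lam.transpose.card = lam.card :=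
  card_map _

theorem fst_lt_card {lam : YoungDiagram} {i j : ℕ} (h : (i, j) ∈ lam) :
    i < lam.card := by
  have hsub : (range (i + 1)).image (fun k => (k, j)) ⊆ lam.cells := by
    intro c hc
    obtain ⟨k, hk, rfl⟩ := mem_image.1 hc
    exact lam.up_left_mem (Nat.lt_succ_iff.1 (mem_range.1 hk)) le_rfl h
  have := card_le_card hsub
  rwa [card_image_of_injective _ (fun a b hab => (Prod.ext_iff.1 hab).1), card_range] at this

theorem finite_card_eq (z : ℤ) : {lam : YoungDiagram | (lam.card : ℤ) = z}.Finite := by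
  refine Set.Finite.of_finite_image (f := YoungDiagram.cells)
    (((range z.toNat ×ˢ range z.toNat).powerset).finite_toSet.subset ?_)
    fun a _ b _ hab => YoungDiagram.ext hab
  rintro _ ⟨lam, hlam, rfl⟩
  simp only [Set.mem_ofPred_eq] at hlam
  simp only [coe_powerset, Set.mem_preimage, Set.mem_powerset_iff, coe_subset]
  rintro ⟨i, j⟩ hc
  have h1 := fst_lt_card ((mem_cells _).1 hc)
  have h2 : j < lam.transpose.card :=
    fst_lt_card (i := j) (j := i) (mem_transpose.2 ((mem_cells _).1 hc))
  rw [card_transpose] at h2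
  simp only [mem_product, mem_range]
  omega

/-- The finite set of Young diagrams with `z` cells. -/
noncomputable def ofCard (z : ℤ) : Finset YoungDiagram :=
  (finite_card_eq z).toFinset

@[simp]
theorem mem_ofCard {z : ℤ} {lam : YoungDiagram} : lam ∈ ofCard z ↔ (lam.card : ℤ) = z := by
  simp [ofCard]

end YoungDiagram

namespace SemistandardYoungTableau

variable {lam tau : YoungDiagram}

/-- All entries of `T` are less than `n`, and the entry `j` occurs `w j` times. Weights are
integers so that they can be subtracted freely. -/
def HasWeight {n : ℕ} (T : SemistandardYoungTableau lam) (w : Fin n → ℤ) : Prop :=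
  (∀ i j, (i, j) ∈ lam → T i j < n) ∧ ∀ j : Fin n, (ssytWeight T j : ℤ) = w j

theorem hasWeight_natCast_iff {n : ℕ} (T : SemistandardYoungTableau lam) (w : Fin n → ℕ) :
    T.HasWeight (fun j => (w j : ℤ)) ↔
      ∀ j : ℕ, ssytWeight T j = if h : j < n then w ⟨j, h⟩ else 0 := by
  constructor
  · rintro ⟨h1, h2⟩ j
    split_ifs with h
    · exact Nat.cast_injective (h2 ⟨j, h⟩)
    · rw [ssytWeight, card_eq_zero, filter_eq_empty_iff]
      rintro ⟨a, b⟩ hc rfl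
      exact h (h1 a b ((YoungDiagram.mem_cells _).1 hc))
  · refine fun h => ⟨fun i j hc => ?_, fun j => by simp [h]⟩
    by_contra hn
    have := h (T i j)
    rw [dif_neg hn, ssytWeight, card_eq_zero, filter_eq_empty_iff] at this
    exact this ((YoungDiagram.mem_cells _).2 hc) rfl

theorem finite_hasWeight {n : ℕ} (w : Fin n → ℤ) :
    {T : SemistandardYoungTableau lam | T.HasWeight w}.Finite := by
  refine Set.Finite.of_finite_image (f := fun T (c : lam.cells) => T c.1.1 c.1.2)
    ((Set.Finite.pi' fun _ => Set.finite_lt_nat n).subset ?_) ?_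
  · rintro _ ⟨T, hT, rfl⟩ c
    exact hT.1 _ _ ((YoungDiagram.mem_cells _).1 c.2)
  · intro T _ S _ h
    ext i j
    by_cases hc : (i, j) ∈ lam
    · exact congrFun h ⟨(i, j), (YoungDiagram.mem_cells _).2 hc⟩
    · rw [T.zeros hc, S.zeros hc]

/-- The cells of `T` with entries less than `n`. -/
def below (T : SemistandardYoungTableau lam) (n : ℕ) : YoungDiagram where
  cells := lam.cells.filter fun c => T c.1 c.2 < n
  isLowerSet := by
    rintro ⟨i, j⟩ ⟨i', j'⟩ ⟨hi, hj⟩ hc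
    simp only [coe_filter, Set.mem_ofPred_eq, YoungDiagram.mem_cells] at hc ⊢
    exact ⟨lam.up_left_mem hi hj hc.1,
      ((T.col_weak hi (lam.up_left_mem le_rfl hj hc.1)).trans
        (T.row_weak_of_le hj hc.1)).trans_lt hc.2⟩

theorem mem_below {T : SemistandardYoungTableau lam} {n i j : ℕ} :
    (i, j) ∈ T.below n ↔ (i, j) ∈ lam ∧ T i j < n := by
  rw [← YoungDiagram.mem_cells, below, mem_filter, YoungDiagram.mem_cells]

/-- Restriction of a tableau to a smaller shape. -/
def restrict (T : SemistandardYoungTableau lam) (h : tau ≤ lam) :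
    SemistandardYoungTableau tau where
  entry i j := if (i, j) ∈ tau then T i j else 0
  row_weak' hj hc := by
    rw [if_pos hc, if_pos (tau.up_left_mem le_rfl hj.le hc)]
    exact T.row_weak hj (h hc)
  col_strict' hi hc := by
    rw [if_pos hc, if_pos (tau.up_left_mem hi.le le_rfl hc)]
    exact T.col_strict hi (h hc)
  zeros' hc := if_neg hc

theorem restrict_apply (T : SemistandardYoungTableau lam) (h : tau ≤ lam) (i j : ℕ) :
    T.restrict h i j = if (i, j) ∈ tau then T i j else 0 := rfl

/-- Extension of a tableau by a horizontal strip filled with a new largest entry `n`. -/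
def extend (S : SemistandardYoungTableau tau) (h : tau.IsHorizontalStrip lam) (n : ℕ)
    (hS : ∀ i j, (i, j) ∈ tau → S i j < n) : SemistandardYoungTableau lam where
  entry i j := if (i, j) ∈ tau then S i j else if (i, j) ∈ lam then n else 0
  row_weak' {i j1 j2} hj hc := by
    by_cases h2 : (i, j2) ∈ tau
    · have h1 := tau.up_left_mem le_rfl hj.le h2
      rw [if_pos h1, if_pos h2]
      exact S.row_weak hj h2
    · rw [if_neg h2, if_pos hc]
      split_ifs with h1 h3
      exacts [(hS _ _ h1).le, le_rfl, Nat.zero_le _]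
  col_strict' {_ i2 _} hi hc := by
    obtain ⟨i2, rfl⟩ : ∃ k, i2 = k + 1 := ⟨i2 - 1, by omega⟩
    have h1 := tau.up_left_mem (Nat.lt_succ_iff.1 hi) le_rfl (h.2 _ _ hc)
    rw [if_pos h1]
    split_ifs with h2
    exacts [S.col_strict hi h2, hS _ _ h1]
  zeros' {i j} hc := by
    rw [if_neg fun h' => hc (h.1 h'), if_neg hc]

theorem extend_apply (S : SemistandardYoungTableau tau) (h : tau.IsHorizontalStrip lam) (n : ℕ)
    (hS : ∀ i j, (i, j) ∈ tau → S i j < n) (i j : ℕ) :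
    S.extend h n hS i j = if (i, j) ∈ tau then S i j else if (i, j) ∈ lam then n else 0 := rfl

theorem isHorizontalStrip_below {T : SemistandardYoungTableau lam} {n : ℕ}
    (hT : ∀ i j, (i, j) ∈ lam → T i j < n + 1) : (T.below n).IsHorizontalStrip lam :=
  ⟨fun _ hc => (mem_below.1 hc).1, fun i _ hc => mem_below.2
    ⟨lam.up_left_mem i.le_succ le_rfl hc,
      (T.col_strict i.lt_succ_self hc).trans_le (Nat.lt_succ_iff.1 (hT _ _ hc))⟩⟩

theorem card_below_add_ssytWeight {T : SemistandardYoungTableau lam} {n : ℕ}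
    (hT : ∀ i j, (i, j) ∈ lam → T i j < n + 1) :
    (T.below n).card + ssytWeight T n = lam.card := by
  rw [YoungDiagram.card, below, ssytWeight, YoungDiagram.card,
    ← card_filter_add_card_filter_not (s := lam.cells) fun c => T c.1 c.2 < n]
  congr 2
  refine filter_congr fun c hc => ?_
  have := hT c.1 c.2 ((YoungDiagram.mem_cells _).1 hc)
  omega

theorem ssytWeight_restrict_below {T : SemistandardYoungTableau lam} {n k : ℕ} (hk : k < n)
    (h : T.below n ≤ lam) : ssytWeight (T.restrict h) k = ssytWeight T k := by
  unfold ssytWeight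
  congr 1
  ext ⟨i, j⟩
  simp only [mem_filter, YoungDiagram.mem_cells, restrict_apply, mem_below]
  grind

theorem below_extend {S : SemistandardYoungTableau tau} (h : tau.IsHorizontalStrip lam) {n : ℕ}
    (hS : ∀ i j, (i, j) ∈ tau → S i j < n) : (S.extend h n hS).below n = tau := by
  ext ⟨i, j⟩
  have h1 := hS i j
  have h2 : (i, j) ∈ tau → (i, j) ∈ lam := fun hc => h.1 hc
  simp only [YoungDiagram.mem_cells, mem_below, extend_apply]
  grind

theorem ssytWeight_extend {S : SemistandardYoungTableau tau} (h : tau.IsHorizontalStrip lam)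
    {n k : ℕ} (hS : ∀ i j, (i, j) ∈ tau → S i j < n) (hk : k < n) :
    ssytWeight (S.extend h n hS) k = ssytWeight S k := by
  unfold ssytWeight
  congr 1
  ext ⟨i, j⟩
  have h2 : (i, j) ∈ tau → (i, j) ∈ lam := fun hc => h.1 hc
  rw [mem_filter, mem_filter]
  simp only [YoungDiagram.mem_cells, extend_apply]
  grind

theorem extend_lt {S : SemistandardYoungTableau tau} (h : tau.IsHorizontalStrip lam) {n : ℕ}
    (hS : ∀ i j, (i, j) ∈ tau → S i j < n) (i j : ℕ) : S.extend h n hS i j < n + 1 := by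
  have h1 := hS i j
  rw [extend_apply]
  grind

/-- The number of semistandard Young tableaux of shape `lam` and integer weight `w`. -/
noncomputable def count (lam : YoungDiagram) {n : ℕ} (w : Fin n → ℤ) : ℕ :=
  Set.ncard {T : SemistandardYoungTableau lam | T.HasWeight w}

theorem tabCard_eq_count (lam : YoungDiagram) {n : ℕ} (w : Fin n → ℕ) :
    tabCard lam w = count lam fun j => (w j : ℤ) := by
  simp only [tabCard, count, hasWeight_natCast_iff]

open Classical in
theorem count_zero (lam : YoungDiagram) (w : Fin 0 → ℤ) :
    count lam w = if lam = ⊥ then 1 else 0 := by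
  split_ifs with h
  · subst h
    refine Set.ncard_eq_one.2 ⟨highestWeight ⊥, Set.eq_singleton_iff_unique_mem.2 ⟨?_, ?_⟩⟩
    · simp [HasWeight]
    · intro T _
      ext i j
      simp [T.zeros (YoungDiagram.notMem_bot (i, j))]
  · rw [count, Set.ncard_eq_zero (finite_hasWeight w), Set.eq_empty_iff_forall_notMem]
    rintro T ⟨hT, -⟩
    refine h (YoungDiagram.ext (eq_empty_of_forall_notMem fun c hc => ?_))
    exact absurd (hT c.1 c.2 ((YoungDiagram.mem_cells _).1 hc)) (Nat.not_lt_zero _)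

/-- Tableaux whose cells with entry less than `n` have shape `tau` are in bijection with tableaux
of shape `tau`. -/
theorem ncard_below_eq {n : ℕ} (w : Fin (n + 1) → ℤ) (h : tau.IsHorizontalStrip lam)
    (hcard : (tau.card : ℤ) = lam.card - w (Fin.last n)) :
    Set.ncard {T : SemistandardYoungTableau lam | T.HasWeight w ∧ T.below n = tau} =
      count tau (Fin.init w) := by
  refine Set.ncard_congr (fun T _ => T.restrict h.1) ?_ ?_ ?_
  · rintro T ⟨hT, rfl⟩
    refine ⟨fun i j hc => ?_, fun k => ?_⟩
    · rw [restrict_apply, if_pos hc]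
      exact (mem_below.1 hc).2
    · rw [ssytWeight_restrict_below k.2]
      exact hT.2 k.castSucc
  · rintro T S ⟨hT, hTt⟩ ⟨hS, hSt⟩ heq
    ext i j
    have h1 : (if (i, j) ∈ tau then T i j else 0) = if (i, j) ∈ tau then S i j else 0 :=
      congrFun (congrFun (congrArg DFunLike.coe heq) i) j
    have h2 : (i, j) ∈ T.below n ↔ (i, j) ∈ tau := by rw [hTt]
    have h3 : (i, j) ∈ S.below n ↔ (i, j) ∈ tau := by rw [hSt]
    rw [mem_below] at h2 h3
    have h4 := hT.1 i j
    have h5 := hS.1 i j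
    have h6 := T.zeros (i := i) (j := j)
    have h7 := S.zeros (i := i) (j := j)
    by_cases hc : (i, j) ∈ lam <;> grind
  · intro S hS
    refine ⟨S.extend h n hS.1, ⟨⟨fun i j _ => extend_lt h hS.1 i j, ?_⟩, below_extend h hS.1⟩, ?_⟩
    · rw [Fin.forall_fin_succ']
      refine ⟨fun k => ?_, ?_⟩
      · rw [Fin.val_castSucc, ssytWeight_extend h hS.1 k.2]
        exact hS.2 k
      · have := card_below_add_ssytWeight fun i j _ => extend_lt h hS.1 i j
        rw [below_extend] at this
        rw [Fin.val_last]
        omega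
    · ext i j
      rw [restrict_apply, extend_apply]
      split_ifs with hc
      exacts [rfl, (S.zeros hc).symm]

open Classical in
/-- Removing the largest entry from a tableau. -/
theorem count_succ (lam : YoungDiagram) {n : ℕ} (w : Fin (n + 1) → ℤ) :
    count lam w = ∑ tau ∈ YoungDiagram.ofCard (lam.card - w (Fin.last n)) with
      tau.IsHorizontalStrip lam, count tau (Fin.init w) := by
  have hmaps : ∀ T ∈ (finite_hasWeight (lam := lam) w).toFinset, T.below n ∈
      (YoungDiagram.ofCard (lam.card - w (Fin.last n))).filter (·.IsHorizontalStrip lam) := by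
    intro T hT
    have hT : T.HasWeight w := by simpa using hT
    have h1 := card_below_add_ssytWeight hT.1
    have h2 := hT.2 (Fin.last n)
    rw [Fin.val_last] at h2
    refine mem_filter.2 ⟨YoungDiagram.mem_ofCard.2 ?_, isHorizontalStrip_below hT.1⟩
    omega
  rw [count, Set.ncard_eq_toFinset_card _ (finite_hasWeight w),
    card_eq_sum_card_fiberwise hmaps]
  refine sum_congr rfl fun tau htau => ?_
  obtain ⟨h1, h2⟩ := mem_filter.1 htau
  rw [← ncard_below_eq w h2 (YoungDiagram.mem_ofCard.1 h1), ← Set.ncard_coe_finset]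
  congr 1
  ext T
  simp

end SemistandardYoungTableau

theorem Finset.card_filter_powerset_card_eq_add {α : Type*} [DecidableEq α] {X Y : Finset α}
    (h : X ⊆ Y) (k : ℕ) :
    #{s ∈ Y.powerset | X ⊆ s ∧ #s = #X + k} = (#Y - #X).choose k := by
  rw [← card_sdiff_of_subset h, ← card_powersetCard]
  refine card_bij' (fun s _ => s \ X) (fun s _ => X ∪ s) ?_ ?_ ?_ ?_
  · intro s hs
    simp only [mem_filter, mem_powerset, mem_powersetCard] at hs ⊢
    refine ⟨sdiff_subset_sdiff hs.1 le_rfl, ?_⟩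
    rw [card_sdiff_of_subset hs.2.1]
    omega
  · intro s hs
    simp only [mem_filter, mem_powerset, mem_powersetCard] at hs ⊢
    refine ⟨union_subset h (hs.1.trans sdiff_subset), subset_union_left, ?_⟩
    rw [card_union_of_disjoint (disjoint_sdiff.mono_right hs.1), hs.2]
  · intro s hs
    simp only [mem_filter] at hs
    exact union_sdiff_of_subset hs.2.1
  · intro s hs
    simp only [mem_powersetCard] at hs
    exact union_sdiff_cancel_left (disjoint_sdiff.mono_right hs.1)

theorem Finset.card_filter_powerset_card_add_eq {α : Type*} [DecidableEq α] {X Y : Finset α}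
    (h : X ⊆ Y) (k : ℕ) :
    #{s ∈ Y.powerset | X ⊆ s ∧ #s + k = #Y} = (#Y - #X).choose k := by
  rw [← card_sdiff_of_subset h, ← card_powersetCard]
  refine card_bij' (fun s _ => Y \ s) (fun s _ => Y \ s) ?_ ?_ ?_ ?_
  · intro s hs
    simp only [mem_filter, mem_powerset, mem_powersetCard] at hs ⊢
    refine ⟨sdiff_subset_sdiff le_rfl hs.2.1, ?_⟩
    rw [card_sdiff_of_subset hs.1]
    omega
  · intro s hs
    simp only [mem_filter, mem_powerset, mem_powersetCard] at hs ⊢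
    have hsY := hs.1.trans sdiff_subset
    refine ⟨sdiff_subset, subset_sdiff.2 ⟨h, disjoint_sdiff.mono_right hs.1⟩, ?_⟩
    rw [card_sdiff_of_subset hsY]
    have := card_le_card hsY
    omega
  · intro s hs
    simp only [mem_filter, mem_powerset] at hs
    exact sdiff_sdiff_eq_self hs.1
  · intro s hs
    simp only [mem_powersetCard] at hs
    exact sdiff_sdiff_eq_self (hs.1.trans sdiff_subset)

namespace YoungDiagram

/-- The largest set of cells that can be obtained from `α` by adding a horizontal strip and from
`β` by adding a vertical strip. -/
def upperCells (α β : YoungDiagram) : Finset (ℕ × ℕ) :=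
  (insert 0 (α.cells ∪ β.cells ∪ α.cells.image (fun c => (c.1 + 1, c.2)) ∪
    β.cells.image fun c => (c.1, c.2 + 1))).filter fun c =>
      (c.1 = 0 ∨ (c.1 - 1, c.2) ∈ α) ∧ (c.2 = 0 ∨ (c.1, c.2 - 1) ∈ β)

/-- The smallest set of cells that can be obtained from `β` by removing a horizontal strip and from
`α` by removing a vertical strip. -/
def lowerCells (α β : YoungDiagram) : Finset (ℕ × ℕ) :=
  (α.cells ∪ β.cells).filter fun c => (c.1 + 1, c.2) ∈ β ∨ (c.1, c.2 + 1) ∈ α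

theorem mem_upperCells {α β : YoungDiagram} {i j : ℕ} : (i, j) ∈ upperCells α β ↔
    (i = 0 ∨ (i - 1, j) ∈ α) ∧ (j = 0 ∨ (i, j - 1) ∈ β) := by
  rw [upperCells, mem_filter, and_iff_right_iff_imp]
  rintro ⟨rfl | h1, rfl | h2⟩
  · simp
  · simp only [mem_insert, mem_union, mem_image, mem_cells]
    rcases j with _ | j
    · simp
    · exact Or.inr (Or.inr ⟨_, h2, rfl⟩)
  · simp only [mem_insert, mem_union, mem_image, mem_cells]
    rcases i with _ | i
    · simp
    · exact Or.inr (Or.inl (Or.inr ⟨_, h1, rfl⟩))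
  · simp only [mem_insert, mem_union, mem_image, mem_cells]
    rcases i with _ | i
    · exact Or.inr (Or.inl (Or.inl (Or.inl h1)))
    · exact Or.inr (Or.inl (Or.inr ⟨_, h1, rfl⟩))

theorem mem_lowerCells {α β : YoungDiagram} {i j : ℕ} : (i, j) ∈ lowerCells α β ↔
    (i + 1, j) ∈ β ∨ (i, j + 1) ∈ α := by
  rw [lowerCells, mem_filter, and_iff_right_iff_imp]
  simp only [mem_union, mem_cells]
  rintro (h | h)
  · exact Or.inr (β.up_left_mem i.le_succ le_rfl h)
  · exact Or.inl (α.up_left_mem le_rfl j.le_succ h)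

theorem card_upperCells_add_card_lowerCells (α β : YoungDiagram) :
    #(upperCells α β) + #(lowerCells α β) = α.card + β.card + 1 := by
  have hα : α.card = #{c ∈ α.cells | c.2 = 0} + #{c ∈ α.cells | c.2 ≠ 0} :=
    (card_filter_add_card_filter_not _).symm
  have hβ : β.card = #{c ∈ β.cells | c.1 = 0} + #{c ∈ β.cells | c.1 ≠ 0} :=
    (card_filter_add_card_filter_not _).symm
  set A := {c ∈ α.cells | c.2 ≠ 0}.image fun c => (c.1, c.2 - 1) with hA
  set B := {c ∈ β.cells | c.1 ≠ 0}.image fun c => (c.1 - 1, c.2) with hB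
  have cA : #A = #{c ∈ α.cells | c.2 ≠ 0} := by
    refine card_image_of_injOn ?_
    rintro ⟨a, b⟩ hab ⟨c, d⟩ hcd h
    simp only [coe_filter, Set.mem_ofPred_eq, Prod.mk.injEq] at hab hcd h ⊢
    omega
  have cB : #B = #{c ∈ β.cells | c.1 ≠ 0} := by
    refine card_image_of_injOn ?_
    rintro ⟨a, b⟩ hab ⟨c, d⟩ hcd h
    simp only [coe_filter, Set.mem_ofPred_eq, Prod.mk.injEq] at hab hcd h ⊢
    omega
  have mA (i j : ℕ) : (i, j) ∈ A ↔ (i, j + 1) ∈ α := by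
    simp only [hA, mem_image, mem_filter, mem_cells, Prod.mk.injEq, Prod.exists]
    constructor
    · rintro ⟨a, b, ⟨h1, h2⟩, rfl, rfl⟩
      rwa [Nat.sub_add_cancel (Nat.one_le_iff_ne_zero.2 h2)]
    · exact fun h => ⟨i, j + 1, ⟨h, by simp⟩, rfl, rfl⟩
  have mB (i j : ℕ) : (i, j) ∈ B ↔ (i + 1, j) ∈ β := by
    simp only [hB, mem_image, mem_filter, mem_cells, Prod.mk.injEq, Prod.exists]
    constructor
    · rintro ⟨a, b, ⟨h1, h2⟩, rfl, rfl⟩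
      rwa [Nat.sub_add_cancel (Nat.one_le_iff_ne_zero.2 h2)]
    · exact fun h => ⟨i + 1, j, ⟨h, by simp⟩, rfl, rfl⟩
  have hlower : lowerCells α β = A ∪ B := by
    ext ⟨i, j⟩
    rw [mem_lowerCells, mem_union, mA, mB, or_comm]
  have hupper : upperCells α β = insert (0, 0)
      ({c ∈ α.cells | c.2 = 0}.image (fun c => (c.1 + 1, c.2)) ∪
        ({c ∈ β.cells | c.1 = 0}.image (fun c => (c.1, c.2 + 1)) ∪
          (A ∩ B).image fun c => (c.1 + 1, c.2 + 1))) := by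
    ext ⟨i, j⟩
    rw [mem_upperCells]
    simp only [mem_insert, mem_union, mem_image, mem_filter, mem_inter, mem_cells, Prod.exists, mA,
      mB, Prod.mk.injEq]
    rcases i with _ | i <;> rcases j with _ | j <;> simp [and_comm]
  rw [hlower, hupper, card_insert_of_notMem (by simp), card_union_of_disjoint,
    card_union_of_disjoint, card_image_of_injective, card_image_of_injective,
    card_image_of_injective]
  · have := card_union_add_card_inter A B
    omega
  · rintro ⟨a, b⟩ ⟨c, d⟩ h
    simpa using h
  · rintro ⟨a, b⟩ ⟨c, d⟩ h
    simpa using h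
  · rintro ⟨a, b⟩ ⟨c, d⟩ h
    simpa using h
  · rw [disjoint_left]
    simp only [mem_image, mem_filter]
    rintro _ ⟨c, ⟨-, hc⟩, rfl⟩ ⟨d, -, hd⟩
    simp [hc] at hd
  · rw [disjoint_left]
    simp only [mem_image, mem_filter, mem_union]
    rintro _ ⟨c, ⟨-, hc⟩, rfl⟩ (⟨d, ⟨-, hd'⟩, hd⟩ | ⟨d, -, hd⟩) <;> simp [hc] at hd

theorem isStrip_upper_iff {α β γ : YoungDiagram} :
    α.IsHorizontalStrip γ ∧ β.IsVerticalStrip γ ↔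
      α.cells ∪ β.cells ⊆ γ.cells ∧ γ.cells ⊆ upperCells α β := by
  simp only [IsHorizontalStrip, IsVerticalStrip, union_subset_iff, cells_subset_iff]
  constructor
  · rintro ⟨⟨h1, h2⟩, h3, h4⟩
    refine ⟨⟨h1, h3⟩, ?_⟩
    rintro ⟨i, j⟩ hc
    rw [mem_cells] at hc
    rw [mem_upperCells]
    refine ⟨?_, ?_⟩
    · rcases i with _ | i
      exacts [Or.inl rfl, Or.inr (h2 _ _ hc)]
    · rcases j with _ | j
      exacts [Or.inl rfl, Or.inr (h4 _ _ hc)]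
  · rintro ⟨⟨h1, h3⟩, h⟩
    refine ⟨⟨h1, fun i j hc => ?_⟩, h3, fun i j hc => ?_⟩
    · simpa using (mem_upperCells.1 (h ((mem_cells _).2 hc))).1
    · simpa using (mem_upperCells.1 (h ((mem_cells _).2 hc))).2

theorem isStrip_lower_iff {α β δ : YoungDiagram} :
    δ.IsHorizontalStrip β ∧ δ.IsVerticalStrip α ↔
      lowerCells α β ⊆ δ.cells ∧ δ.cells ⊆ α.cells ∩ β.cells := by
  simp only [IsHorizontalStrip, IsVerticalStrip, subset_inter_iff, cells_subset_iff]
  constructor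
  · rintro ⟨⟨h1, h2⟩, h3, h4⟩
    refine ⟨?_, h3, h1⟩
    rintro ⟨i, j⟩ hc
    exact (mem_lowerCells.1 hc).elim (h2 _ _) (h4 _ _)
  · rintro ⟨h, h3, h1⟩
    exact ⟨⟨h1, fun i j hc => (mem_cells _).1 (h (mem_lowerCells.2 (Or.inl hc)))⟩,
      h3, fun i j hc => (mem_cells _).1 (h (mem_lowerCells.2 (Or.inr hc)))⟩

theorem isLowerSet_of_subset_upperCells {α β : YoungDiagram} {s : Finset (ℕ × ℕ)}
    (h1 : α.cells ∪ β.cells ⊆ s) (h2 : s ⊆ upperCells α β) : IsLowerSet (s : Set (ℕ × ℕ)) := by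
  rintro ⟨i, j⟩ ⟨i', j'⟩ ⟨hi, hj⟩ hc
  dsimp only at hi hj
  rw [mem_coe] at hc ⊢
  obtain ⟨h3, h4⟩ := mem_upperCells.1 (h2 hc)
  rcases hi.eq_or_lt with rfl | hi
  · rcases hj.eq_or_lt with rfl | hj
    · exact hc
    · exact h1 (mem_union_right _ ((mem_cells _).2
        (β.up_left_mem le_rfl (by omega) (h4.resolve_left (by omega)))))
  · exact h1 (mem_union_left _ ((mem_cells _).2
      (α.up_left_mem (by omega) hj (h3.resolve_left (by omega)))))

theorem isLowerSet_of_lowerCells_subset {α β : YoungDiagram} {s : Finset (ℕ × ℕ)}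
    (h1 : lowerCells α β ⊆ s) (h2 : s ⊆ α.cells ∩ β.cells) : IsLowerSet (s : Set (ℕ × ℕ)) := by
  rintro ⟨i, j⟩ ⟨i', j'⟩ ⟨hi, hj⟩ hc
  dsimp only at hi hj
  rw [mem_coe] at hc ⊢
  obtain ⟨h3, h4⟩ := mem_inter.1 (h2 hc)
  rw [mem_cells] at h3 h4
  rcases hi.eq_or_lt with rfl | hi
  · rcases hj.eq_or_lt with rfl | hj
    · exact hc
    · exact h1 (mem_lowerCells.2 (Or.inr (α.up_left_mem le_rfl hj h3)))
  · exact h1 (mem_lowerCells.2 (Or.inl (β.up_left_mem hi hj h4)))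

theorem union_subset_upperCells_iff {α β : YoungDiagram} :
    α.cells ∪ β.cells ⊆ upperCells α β ↔ lowerCells α β ⊆ α.cells ∩ β.cells := by
  constructor
  · rintro h ⟨i, j⟩ hc
    rw [mem_inter, mem_cells, mem_cells]
    rcases mem_lowerCells.1 hc with hc | hc
    · refine ⟨?_, β.up_left_mem i.le_succ le_rfl hc⟩
      simpa using (mem_upperCells.1 (h (mem_union_right _ ((mem_cells _).2 hc)))).1
    · refine ⟨α.up_left_mem le_rfl j.le_succ hc, ?_⟩
      simpa using (mem_upperCells.1 (h (mem_union_left _ ((mem_cells _).2 hc)))).2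
  · rintro h ⟨i, j⟩ hc
    rw [mem_union, mem_cells, mem_cells] at hc
    rw [mem_upperCells]
    rcases hc with hc | hc
    · refine ⟨Or.inr (α.up_left_mem (Nat.sub_le _ _) le_rfl hc), ?_⟩
      rcases j with _ | j
      exacts [Or.inl rfl, Or.inr ((mem_cells _).1
        (mem_inter.1 (h (mem_lowerCells.2 (Or.inr hc)))).2)]
    · refine ⟨?_, Or.inr (β.up_left_mem le_rfl (Nat.sub_le _ _) hc)⟩
      rcases i with _ | i
      exacts [Or.inl rfl, Or.inr ((mem_cells _).1
        (mem_inter.1 (h (mem_lowerCells.2 (Or.inl hc)))).1)]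

/-- The number of diagrams with `z` cells whose cells lie between `X` and `Y`, provided that all
intermediate sets of cells are diagrams. -/
theorem card_between {X Y : Finset (ℕ × ℕ)} {p : YoungDiagram → Prop} [DecidablePred p]
    (hp : ∀ γ, p γ ↔ X ⊆ γ.cells ∧ γ.cells ⊆ Y)
    (hXY : ∀ s : Finset (ℕ × ℕ), X ⊆ s → s ⊆ Y → IsLowerSet (s : Set (ℕ × ℕ))) (z : ℤ) :
    #{γ ∈ ofCard z | p γ} = #{s ∈ Y.powerset | X ⊆ s ∧ (#s : ℤ) = z} := by
  refine card_bij (fun γ _ => γ.cells) ?_ (fun _ _ _ _ h => YoungDiagram.ext h) ?_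
  · intro γ hγ
    simp only [mem_filter, mem_ofCard, hp, mem_powerset] at hγ ⊢
    exact ⟨hγ.2.2, hγ.2.1, hγ.1⟩
  · intro s hs
    simp only [mem_filter, mem_powerset] at hs
    refine ⟨⟨s, hXY s hs.2.1 hs.1⟩, ?_, rfl⟩
    simp only [mem_filter, mem_ofCard, hp]
    exact ⟨hs.2.2, hs.2.1, hs.1⟩

open Classical in
/-- The local rule: commuting the addition of a horizontal strip with the removal of a vertical
strip. -/
theorem card_strips (α β : YoungDiagram) (z : ℤ) :
    #{γ ∈ ofCard z | α.IsHorizontalStrip γ ∧ β.IsVerticalStrip γ} =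
      #{δ ∈ ofCard (α.card + β.card - z) | δ.IsHorizontalStrip β ∧ δ.IsVerticalStrip α} +
      #{δ ∈ ofCard (α.card + β.card - z + 1) | δ.IsHorizontalStrip β ∧ δ.IsVerticalStrip α} := by
  rw [card_between (fun _ => isStrip_upper_iff) (fun _ => isLowerSet_of_subset_upperCells),
    card_between (fun _ => isStrip_lower_iff) (fun _ => isLowerSet_of_lowerCells_subset),
    card_between (fun _ => isStrip_lower_iff) (fun _ => isLowerSet_of_lowerCells_subset)]
  have hcard := card_upperCells_add_card_lowerCells α β
  have hinter : #(α.cells ∪ β.cells) + #(α.cells ∩ β.cells) = α.card + β.card :=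
    card_union_add_card_inter _ _
  have hiff := union_subset_upperCells_iff (α := α) (β := β)
  generalize α.cells ∪ β.cells = X at *
  generalize α.cells ∩ β.cells = Y at *
  generalize upperCells α β = Q at *
  generalize lowerCells α β = R at *
  by_cases hX : X ⊆ Q
  swap
  · have hR : ¬R ⊆ Y := fun h => hX (hiff.2 h)
    have hempty {U V : Finset (ℕ × ℕ)} (h : ¬U ⊆ V) (z : ℤ) :
        #{s ∈ V.powerset | U ⊆ s ∧ (#s : ℤ) = z} = 0 := by
      rw [card_eq_zero, filter_eq_empty_iff]
      exact fun s hs hs' => h (hs'.1.trans (mem_powerset.1 hs))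
    rw [hempty hX, hempty hR, hempty hR]
  have hR := hiff.1 hX
  have h1 := card_le_card hX
  have h2 := card_le_card hR
  have hup (k : ℕ) (z : ℤ) (hz : z = #X + k) :
      #{s ∈ Q.powerset | X ⊆ s ∧ (#s : ℤ) = z} = (#Y - #R + 1).choose k := by
    rw [show #Y - #R + 1 = #Q - #X by omega, ← card_filter_powerset_card_eq_add hX]
    congr 1
    refine filter_congr fun s _ => and_congr_right fun _ => ?_
    omega
  have hdown (k : ℕ) (z : ℤ) (hz : z + k = #Y) :
      #{s ∈ Y.powerset | R ⊆ s ∧ (#s : ℤ) = z} = (#Y - #R).choose k := by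
    rw [← card_filter_powerset_card_add_eq hR]
    congr 1
    refine filter_congr fun s _ => and_congr_right fun _ => ?_
    omega
  have hup0 (z : ℤ) (hz : z < #X) : #{s ∈ Q.powerset | X ⊆ s ∧ (#s : ℤ) = z} = 0 := by
    rw [card_eq_zero, filter_eq_empty_iff]
    rintro s - ⟨hs, rfl⟩
    have := card_le_card hs
    omega
  have hdown0 (z : ℤ) (hz : #Y < z) : #{s ∈ Y.powerset | R ⊆ s ∧ (#s : ℤ) = z} = 0 := by
    rw [card_eq_zero, filter_eq_empty_iff]
    rintro s hs ⟨-, rfl⟩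
    have := card_le_card (mem_powerset.1 hs)
    omega
  obtain hz | ⟨k, hk⟩ : z < #X ∨ ∃ k : ℕ, z = #X + k := by
    rcases lt_or_ge z #X with h | h
    exacts [Or.inl h, Or.inr ⟨(z - #X).toNat, by omega⟩]
  · rw [hup0 z hz, hdown0 _ (by omega), hdown0 _ (by omega)]
  · rcases k with _ | k
    · rw [hup 0 z hk, hdown 0 _ (by omega), hdown0 _ (by omega), Nat.choose_zero_right,
        Nat.choose_zero_right]
    · rw [hup _ z hk, hdown (k + 1) _ (by omega), hdown k _ (by omega), Nat.choose_succ_succ,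
        add_comm]

end YoungDiagram

namespace SemistandardYoungTableau

open YoungDiagram

open Classical in
/-- Removing the largest entry from a tableau of transposed shape. -/
theorem count_transpose_succ (lam : YoungDiagram) {n : ℕ} (w : Fin (n + 1) → ℤ) :
    count lam.transpose w = ∑ tau ∈ ofCard (lam.card - w (Fin.last n)) with
      tau.IsVerticalStrip lam, count tau.transpose (Fin.init w) := by
  rw [count_succ]
  refine sum_bij' (fun tau _ => tau.transpose) (fun tau _ => tau.transpose) ?_ ?_ ?_ ?_ ?_
  · intro tau h
    rw [mem_filter, mem_ofCard, card_transpose] at h ⊢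
    rwa [← isHorizontalStrip_transpose, transpose_transpose]
  · intro tau h
    rw [mem_filter, mem_ofCard] at h ⊢
    rwa [card_transpose, card_transpose, isHorizontalStrip_transpose]
  · exact fun tau _ => transpose_transpose tau
  · exact fun tau _ => transpose_transpose tau
  · exact fun tau _ => by rw [transpose_transpose]

/-- Sums over 0-1 vectors split according to the last entry. -/
theorem sum_fin_two_snoc {n : ℕ} (f : (Fin (n + 1) → Fin 2) → ℕ) :
    ∑ ε, f ε = ∑ ε : Fin n → Fin 2, f (Fin.snoc ε 0) + ∑ ε : Fin n → Fin 2, f (Fin.snoc ε 1) := by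
  rw [← (Fin.snocEquiv fun _ : Fin (n + 1) => Fin 2).sum_comp, Fintype.sum_prod_type,
    Fin.sum_univ_two]
  rfl

/-- The 0-1 vector `ε`, with integer entries. -/
def bits {n : ℕ} (ε : Fin n → Fin 2) (j : Fin n) : ℤ := ((ε j : ℕ) : ℤ)

open Classical in
/-- The dual Pieri rule, skew form: summing over the additions of a horizontal strip to `kap` is the
same as lowering the weight by a 0-1 vector. -/
theorem sum_count_transpose_isHorizontalStrip {n : ℕ} (w : Fin n → ℤ) (kap : YoungDiagram)
    (a : ℤ) :
    ∑ lam ∈ ofCard (kap.card + a) with kap.IsHorizontalStrip lam, count lam.transpose w =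
      ∑ ε : Fin n → Fin 2 with ∑ j, bits ε j = a, count kap.transpose (w - bits ε) := by
  induction n generalizing kap a with
  | zero =>
    have hbot : (⊥ : YoungDiagram).transpose = ⊥ := rfl
    have h (lam : YoungDiagram) : lam.transpose = ⊥ ↔ lam = ⊥ := by
      rw [transpose_eq_iff_eq_transpose, hbot]
    have hs : kap.IsHorizontalStrip ⊥ ↔ kap = ⊥ :=
      ⟨fun h => le_bot_iff.1 h.1, fun h => ⟨h.le, fun _ _ hc => absurd hc (notMem_bot _)⟩⟩
    simp only [count_zero, h, sum_filter, sum_ite_eq', mem_filter, hs]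
    by_cases hk : kap = ⊥ <;> simp [hk, eq_comm (a := a)]
  | succ n ih =>
    have hlast (b : Fin 2) (ε : Fin n → Fin 2) :
        count kap.transpose (w - bits (Fin.snoc ε b : Fin (n + 1) → Fin 2)) =
          ∑ del ∈ ofCard (kap.card - (w (Fin.last n) - (b : ℕ))) with del.IsVerticalStrip kap,
            count del.transpose (Fin.init w - bits ε) := by
      have h1 : (w - bits (Fin.snoc ε b : Fin (n + 1) → Fin 2)) (Fin.last n) =
          w (Fin.last n) - (b : ℕ) := by simp [bits]
      have h2 : Fin.init (w - bits (Fin.snoc ε b : Fin (n + 1) → Fin 2)) =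
          Fin.init w - bits ε := by ext j; simp [bits, Fin.init]
      rw [count_transpose_succ, h1, h2]
    have hsum (b : Fin 2) (ε : Fin n → Fin 2) :
        ∑ j, bits (Fin.snoc ε b : Fin (n + 1) → Fin 2) j = ∑ j, bits ε j + (b : ℕ) := by
      simp [bits, Fin.sum_univ_castSucc]
    have hlocal (tau : YoungDiagram) (htau : tau ∈ ofCard (kap.card + a - w (Fin.last n))) :
        #{lam ∈ ofCard (kap.card + a) | kap.IsHorizontalStrip lam ∧ tau.IsVerticalStrip lam} =
          #{del ∈ ofCard (kap.card - w (Fin.last n)) |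
            del.IsHorizontalStrip tau ∧ del.IsVerticalStrip kap} +
          #{del ∈ ofCard (kap.card - (w (Fin.last n) - 1)) |
            del.IsHorizontalStrip tau ∧ del.IsVerticalStrip kap} := by
      rw [mem_ofCard] at htau
      rw [card_strips, htau]
      congr 4 <;> ring
    have hihs (b : Fin 2) :
        ∑ tau ∈ ofCard (kap.card + a - w (Fin.last n)),
          #{del ∈ ofCard (kap.card - (w (Fin.last n) - (b : ℕ))) |
            del.IsHorizontalStrip tau ∧ del.IsVerticalStrip kap} *
              count tau.transpose (Fin.init w) =
        ∑ ε : Fin n → Fin 2 with ∑ j, bits ε j + (b : ℕ) = a,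
          count kap.transpose (w - bits (Fin.snoc ε b : Fin (n + 1) → Fin 2)) := by
      simp only [hlast, card_filter, sum_mul]
      rw [sum_comm, sum_comm (s := univ.filter _), sum_filter]
      refine sum_congr rfl fun del hdel => ?_
      rw [mem_ofCard] at hdel
      split_ifs with hv
      · simp only [hv, and_true, ite_mul, one_mul, zero_mul, ← eq_sub_iff_add_eq]
        rw [← ih, sum_filter, hdel]
        congr 2
        ring
      · simp [hv]
    calc ∑ lam ∈ ofCard (kap.card + a) with kap.IsHorizontalStrip lam, count lam.transpose w
        = ∑ lam ∈ ofCard (kap.card + a), ∑ tau ∈ ofCard (kap.card + a - w (Fin.last n)),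
            if kap.IsHorizontalStrip lam ∧ tau.IsVerticalStrip lam then
              count tau.transpose (Fin.init w) else 0 := by
          rw [sum_filter]
          refine sum_congr rfl fun lam hlam => ?_
          rw [mem_ofCard] at hlam
          split_ifs with h
          · rw [count_transpose_succ, hlam, sum_filter]
            simp [h]
          · simp [h]
      _ = ∑ tau ∈ ofCard (kap.card + a - w (Fin.last n)),
            #{lam ∈ ofCard (kap.card + a) | kap.IsHorizontalStrip lam ∧ tau.IsVerticalStrip lam} *
              count tau.transpose (Fin.init w) := by
          rw [sum_comm]
          simp only [card_filter, sum_mul, ite_mul, one_mul, zero_mul]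
      _ = _ := by
          rw [sum_filter, sum_fin_two_snoc]
          simp only [hsum, ← sum_filter, ← hihs]
          rw [← sum_add_distrib]
          refine sum_congr rfl fun tau htau => ?_
          rw [hlocal tau htau, add_mul]
          simp

open Classical in
theorem count_bot {n : ℕ} (w : Fin n → ℤ) : count ⊥ w = if w = 0 then 1 else 0 := by
  have hw (T : SemistandardYoungTableau ⊥) : T.HasWeight w ↔ w = 0 := by
    simp [HasWeight, ssytWeight, funext_iff, eq_comm]
  have : Unique (SemistandardYoungTableau ⊥) :=
    { default := highestWeight ⊥
      uniq := fun T => by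
        ext i j
        simp [T.zeros (notMem_bot (i, j))] }
  simp only [count, hw]
  split_ifs with h <;> simp [h]

/-- The number of 0-1 matrices with integer row sums `u` and column sums `v`. -/
def binaryMatrixCount {m n : ℕ} (u : Fin m → ℤ) (v : Fin n → ℤ) : ℕ :=
  #{A : Fin m → Fin n → Fin 2 | (∀ i, ∑ j, bits (A i) j = u i) ∧ ∑ i, bits (A i) = v}

theorem binaryMatrixCount_succ {m n : ℕ} (u : Fin (m + 1) → ℤ) (v : Fin n → ℤ) :
    binaryMatrixCount u v = ∑ ε : Fin n → Fin 2 with ∑ j, bits ε j = u (Fin.last m),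
      binaryMatrixCount (Fin.init u) (v - bits ε) := by
  simp only [binaryMatrixCount, card_filter]
  rw [← (Fin.snocEquiv fun _ : Fin (m + 1) => Fin n → Fin 2).sum_comp, Fintype.sum_prod_type,
    sum_filter]
  refine sum_congr rfl fun ε _ => ?_
  have hiff (B : Fin m → Fin n → Fin 2) :
      ((∀ i, ∑ j, bits ((Fin.snocEquiv fun _ : Fin (m + 1) => Fin n → Fin 2) (ε, B) i) j = u i) ∧
        ∑ i, bits ((Fin.snocEquiv fun _ : Fin (m + 1) => Fin n → Fin 2) (ε, B) i) = v) ↔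
      ∑ j, bits ε j = u (Fin.last m) ∧
        (∀ i, ∑ j, bits (B i) j = Fin.init u i) ∧ ∑ i, bits (B i) = v - bits ε := by
    rw [Fin.forall_fin_succ', Fin.sum_univ_castSucc, eq_sub_iff_add_eq]
    simp only [Fin.snocEquiv_apply, Fin.snoc_castSucc, Fin.snoc_last, Fin.init]
    tauto
  simp only [hiff]
  split_ifs with h <;> simp [h]

open Classical in
/-- The dual RSK identity for integer weights. -/
theorem sum_count_mul_count {m n : ℕ} (u : Fin m → ℤ) (v : Fin n → ℤ) :
    ∑ lam ∈ ofCard (∑ i, u i), count lam.transpose v * count lam u = binaryMatrixCount u v := by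
  induction m generalizing v with
  | zero =>
    have hbot : (⊥ : YoungDiagram).transpose = ⊥ := rfl
    simp only [count_zero, binaryMatrixCount, card_filter]
    simp [count_bot, hbot, eq_comm (a := v)]
  | succ m ih =>
    rw [binaryMatrixCount_succ]
    simp only [← ih]
    have hu : ∑ i, u i = ∑ i, Fin.init u i + u (Fin.last m) := Fin.sum_univ_castSucc u
    calc ∑ lam ∈ ofCard (∑ i, u i), count lam.transpose v * count lam u
        = ∑ lam ∈ ofCard (∑ i, u i), ∑ kap ∈ ofCard (∑ i, Fin.init u i),
            if kap.IsHorizontalStrip lam then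
              count lam.transpose v * count kap (Fin.init u) else 0 := by
          refine sum_congr rfl fun lam hlam => ?_
          rw [mem_ofCard] at hlam
          rw [count_succ, hlam, hu, add_sub_cancel_right, sum_filter, mul_sum]
          simp only [mul_ite, mul_zero]
      _ = ∑ kap ∈ ofCard (∑ i, Fin.init u i), (∑ lam ∈ ofCard (kap.card + u (Fin.last m)) with
            kap.IsHorizontalStrip lam, count lam.transpose v) * count kap (Fin.init u) := by
          rw [sum_comm]
          refine sum_congr rfl fun kap hkap => ?_
          rw [mem_ofCard] at hkap
          rw [hkap, ← hu, sum_filter, sum_mul]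
          simp only [ite_mul, zero_mul]
      _ = _ := by
          simp only [sum_count_transpose_isHorizontalStrip, sum_mul]
          rw [sum_comm]

end SemistandardYoungTableau

open SemistandardYoungTableau in
theorem ncard_binaryMatrix {m n : ℕ} (μ : Fin m → ℕ) (ν : Fin n → ℕ) :
    Set.ncard {A : Matrix (Fin m) (Fin n) ℕ |
        (∀ i j, A i j ≤ 1) ∧ (∀ i, ∑ j, A i j = μ i) ∧ (∀ j, ∑ i, A i j = ν j)} =
      binaryMatrixCount (fun i => (μ i : ℤ)) fun j => (ν j : ℤ) := by
  rw [binaryMatrixCount, ← Set.ncard_coe_finset]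
  have hinj : Function.Injective fun (B : Fin m → Fin n → Fin 2) =>
      (Matrix.of fun i j => (B i j : ℕ)) := fun B C h => by
    ext i j
    exact congrFun (congrFun h i) j
  rw [← Set.ncard_image_of_injective _ hinj]
  congr 1
  ext A
  simp only [coe_filter, mem_univ, true_and, Set.mem_image, Set.mem_ofPred_eq, bits, funext_iff,
    Finset.sum_apply]
  norm_cast
  constructor
  · rintro ⟨h1, h2, h3⟩
    exact ⟨fun i j => ⟨A i j, Nat.lt_succ_iff.2 (h1 i j)⟩, ⟨h2, h3⟩, rfl⟩
  · rintro ⟨B, ⟨h2, h3⟩, rfl⟩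
    exact ⟨fun i j => Nat.lt_succ_iff.1 (B i j).2, h2, h3⟩

/-- **Dual RSK correspondence, enumerative form.** The number of `m × n` matrices with entries
in `{0,1}`, row sums `μ` and column sums `ν` (both summing to `d`) equals
`∑_{λ ⊢ d} |Tab(λ',ν)| · |Tab(λ,μ)|`, where `λ'` is the conjugate partition. -/
theorem dual_rsk_card (m n d : ℕ) (μ : Fin m → ℕ) (ν : Fin n → ℕ)
    (hμ : ∑ i, μ i = d) (hν : ∑ j, ν j = d) :
    Set.ncard {A : Matrix (Fin m) (Fin n) ℕ |
        (∀ i j, A i j ≤ 1) ∧ (∀ i, ∑ j, A i j = μ i) ∧ (∀ j, ∑ i, A i j = ν j)} =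
      ∑ᶠ (lam : YoungDiagram) (_ : lam.card = d),
        tabCard lam.transpose ν * tabCard lam μ := by
  have hset : {lam : YoungDiagram | lam.card = d} =
      (YoungDiagram.ofCard (∑ i, (μ i : ℤ)) : Set YoungDiagram) := by
    ext lam
    rw [Set.mem_ofPred_eq, mem_coe, YoungDiagram.mem_ofCard, ← hμ]
    norm_cast
  rw [ncard_binaryMatrix, ← SemistandardYoungTableau.sum_count_mul_count,
    ← finsum_mem_coe_finset, ← hset]
  simp only [SemistandardYoungTableau.tabCard_eq_count, Set.mem_ofPred_eq]
end

section
/- For every nonnegative integer vector ν = (ν_1,…,ν_n) with sum d, the number of symmetric n×n matrices with nonnegative integer entries whose j-th row (equivalently, column) sums to ν_j equals the sum, over all partitions λ of d, of |Tab(λ,ν)|. -/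
open scoped ENNReal

/-- `Interlaces μ lam` says that `lam / μ` is a horizontal strip. -/
def Interlaces (μ lam : YoungDiagram) : Prop :=
  ∀ i, μ.rowLen i ≤ lam.rowLen i ∧ lam.rowLen (i + 1) ≤ μ.rowLen i

namespace YoungDiagram

theorem ext_rowLen {μ lam : YoungDiagram} (h : ∀ i, μ.rowLen i = lam.rowLen i) : μ = lam := by
  ext ⟨i, j⟩
  rw [mem_cells, mem_cells, mem_iff_lt_rowLen, mem_iff_lt_rowLen, h]

theorem rowLen_eq_zero {μ : YoungDiagram} {i : ℕ} (h : μ.colLen 0 ≤ i) : μ.rowLen i = 0 := by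
  by_contra hne
  have : (i, 0) ∈ μ := mem_iff_lt_rowLen.2 (Nat.pos_of_ne_zero hne)
  rw [mem_iff_lt_colLen] at this
  omega

theorem card_eq_sum_rowLen {μ : YoungDiagram} {N : ℕ} (h : μ.colLen 0 ≤ N) :
    μ.card = ∑ i ∈ Finset.range N, μ.rowLen i := by
  rw [YoungDiagram.card, Finset.card_eq_sum_card_fiberwise (f := Prod.fst) (t := Finset.range N)]
  · exact Finset.sum_congr rfl fun i _ => (rowLen_eq_card μ).symm
  · rintro ⟨i, j⟩ hc
    have h0 : (i, 0) ∈ μ := μ.up_left_mem le_rfl (Nat.zero_le j) ((mem_cells _).1 hc)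
    rw [mem_iff_lt_colLen] at h0
    simp only [Finset.coe_range, Set.mem_Iio]
    omega

/-- The Young diagram whose `i`-th row has length `f i`. -/
def ofRowLenFun (f : ℕ → ℕ) (hf : Antitone f) (N : ℕ) : YoungDiagram where
  cells := (Finset.range N ×ˢ Finset.range (f 0)).filter fun c => c.2 < f c.1
  isLowerSet := by
    rintro ⟨i, j⟩ ⟨i', j'⟩ ⟨hi, hj⟩ hc
    simp only [Finset.coe_filter, Finset.mem_product, Finset.mem_range, Set.mem_ofPred_eq] at *
    have h1 := hf hi
    have h2 := hf (Nat.zero_le i')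
    omega

theorem rowLen_ofRowLenFun (f : ℕ → ℕ) (hf : Antitone f) (N : ℕ) (hN : f N = 0) (i : ℕ) :
    (ofRowLenFun f hf N).rowLen i = f i := by
  refine eq_of_forall_lt_iff fun j => ?_
  rw [← mem_iff_lt_rowLen, ← mem_cells]
  simp only [ofRowLenFun, Finset.mem_filter, Finset.mem_product, Finset.mem_range]
  have h2 := hf (Nat.zero_le i)
  have h3 : N ≤ i → f i ≤ f N := fun h => hf h
  constructor
  · exact fun h => h.2
  · intro h
    omega

end YoungDiagram

theorem Interlaces.le {μ lam : YoungDiagram} (h : Interlaces μ lam) : μ ≤ lam := by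
  rintro ⟨i, j⟩ hc
  have hc : (i, j) ∈ μ := hc
  rw [YoungDiagram.mem_iff_lt_rowLen] at hc
  exact YoungDiagram.mem_iff_lt_rowLen.2 (hc.trans_le (h i).1)

theorem Interlaces.card_le {μ lam : YoungDiagram} (h : Interlaces μ lam) : μ.card ≤ lam.card :=
  Finset.card_le_card h.le

theorem interlaces_iff {μ lam : YoungDiagram} :
    Interlaces μ lam ↔ μ ≤ lam ∧ ∀ i j, (i + 1, j) ∈ lam → (i, j) ∈ μ := by
  refine ⟨fun h => ⟨h.le, fun i j hc => ?_⟩, fun h i => ⟨?_, ?_⟩⟩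
  · rw [YoungDiagram.mem_iff_lt_rowLen] at hc ⊢
    exact hc.trans_le (h i).2
  · refine le_of_forall_lt fun j hj => ?_
    exact YoungDiagram.mem_iff_lt_rowLen.1 (h.1 (YoungDiagram.mem_iff_lt_rowLen.2 hj))
  · refine le_of_forall_lt fun j hj => ?_
    exact YoungDiagram.mem_iff_lt_rowLen.1 (h.2 i j (YoungDiagram.mem_iff_lt_rowLen.2 hj))

/-- The row lengths produced from `μ`, `ν`, `ρ` and a new first row by the local RSK rule. -/
def growthRow (μ ν ρ : YoungDiagram) (k : ℕ) : ℕ → ℕ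
  | 0 => max (μ.rowLen 0) (ν.rowLen 0) + k
  | i + 1 => max (μ.rowLen (i + 1)) (ν.rowLen (i + 1)) + min (μ.rowLen i) (ν.rowLen i) - ρ.rowLen i

/-- The row lengths recovered from `μ`, `ν` and `lam` by the inverse of the local RSK rule. -/
def shrinkRow (μ ν lam : YoungDiagram) (i : ℕ) : ℕ :=
  max (μ.rowLen (i + 1)) (ν.rowLen (i + 1)) + min (μ.rowLen i) (ν.rowLen i) - lam.rowLen (i + 1)

theorem antitone_growthRow {μ ν ρ : YoungDiagram} (hμ : Interlaces ρ μ) (hν : Interlaces ρ ν)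
    (k : ℕ) : Antitone (growthRow μ ν ρ k) := by
  refine antitone_nat_of_succ_le fun i => ?_
  cases i with
  | zero =>
    have := hμ 0; have := hν 0
    simp only [growthRow]
    omega
  | succ i =>
    have := hμ i; have := hν i; have := hμ (i + 1); have := hν (i + 1)
    simp only [growthRow]
    omega

theorem growthRow_eq_zero {μ ν ρ : YoungDiagram} (k : ℕ) :
    growthRow μ ν ρ k (max (μ.colLen 0) (ν.colLen 0) + 1) = 0 := by
  have h1 := YoungDiagram.rowLen_eq_zero (le_max_left (μ.colLen 0) (ν.colLen 0))
  have h2 := YoungDiagram.rowLen_eq_zero (le_max_right (μ.colLen 0) (ν.colLen 0))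
  have h3 := μ.rowLen_anti _ _ (Nat.le_add_right (max (μ.colLen 0) (ν.colLen 0)) 1)
  have h4 := ν.rowLen_anti _ _ (Nat.le_add_right (max (μ.colLen 0) (ν.colLen 0)) 1)
  simp only [growthRow]
  omega

theorem antitone_shrinkRow {μ ν lam : YoungDiagram} (hμ : Interlaces μ lam)
    (hν : Interlaces ν lam) : Antitone (shrinkRow μ ν lam) := by
  refine antitone_nat_of_succ_le fun i => ?_
  have := hμ i; have := hν i; have := hμ (i + 1); have := hν (i + 1)
  have := hμ (i + 1 + 1); have := hν (i + 1 + 1)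
  simp only [shrinkRow]
  omega

theorem shrinkRow_eq_zero {μ ν lam : YoungDiagram} :
    shrinkRow μ ν lam (max (μ.colLen 0) (ν.colLen 0)) = 0 := by
  have h1 := YoungDiagram.rowLen_eq_zero (le_max_left (μ.colLen 0) (ν.colLen 0))
  have h2 := YoungDiagram.rowLen_eq_zero (le_max_right (μ.colLen 0) (ν.colLen 0))
  have h3 := μ.rowLen_anti _ _ (Nat.le_add_right (max (μ.colLen 0) (ν.colLen 0)) 1)
  have h4 := ν.rowLen_anti _ _ (Nat.le_add_right (max (μ.colLen 0) (ν.colLen 0)) 1)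
  simp only [shrinkRow]
  omega

/-- The local RSK rule: a bijection between the common successors of `μ` and `ν` and pairs of a
common predecessor and a natural number. -/
def growthEquiv (μ ν : YoungDiagram) :
    {lam // Interlaces μ lam ∧ Interlaces ν lam} ≃ {ρ // Interlaces ρ μ ∧ Interlaces ρ ν} × ℕ where
  toFun lam :=
    (⟨YoungDiagram.ofRowLenFun _ (antitone_shrinkRow lam.2.1 lam.2.2)
        (max (μ.colLen 0) (ν.colLen 0)), by
      obtain ⟨lam, hμ, hν⟩ := lam
      constructor <;> intro i <;>
        rw [YoungDiagram.rowLen_ofRowLenFun _ _ _ shrinkRow_eq_zero] <;>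
        simp only [shrinkRow] <;>
        have := hμ i <;> have := hν i <;> have := hμ (i + 1) <;> have := hν (i + 1) <;> omega⟩,
      lam.1.rowLen 0 - max (μ.rowLen 0) (ν.rowLen 0))
  invFun p :=
    ⟨YoungDiagram.ofRowLenFun _ (antitone_growthRow p.1.2.1 p.1.2.2 p.2)
        (max (μ.colLen 0) (ν.colLen 0) + 1), by
      obtain ⟨⟨ρ, hμ, hν⟩, k⟩ := p
      constructor <;> rintro (_ | i) <;>
        simp only [YoungDiagram.rowLen_ofRowLenFun _ _ _ (growthRow_eq_zero k), growthRow] <;>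
        first
        | (have := hμ 0; have := hν 0; have := hμ 1; have := hν 1
           simp only [zero_add] at *
           omega)
        | (have := hμ i; have := hν i; have := hμ (i + 1); have := hν (i + 1)
           omega)⟩
  left_inv := by
    rintro ⟨lam, hμ, hν⟩
    refine Subtype.ext (YoungDiagram.ext_rowLen ?_)
    rintro (_ | i) <;> simp only [YoungDiagram.rowLen_ofRowLenFun _ _ _ (growthRow_eq_zero _),
      YoungDiagram.rowLen_ofRowLenFun _ _ _ shrinkRow_eq_zero, growthRow, shrinkRow]
    · have := hμ 0; have := hν 0
      omega
    · have := hμ i; have := hν i; have := hμ (i + 1); have := hν (i + 1)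
      omega
  right_inv := by
    rintro ⟨⟨ρ, hμ, hν⟩, k⟩
    refine Prod.ext (Subtype.ext (YoungDiagram.ext_rowLen fun i => ?_)) ?_
    · rw [YoungDiagram.rowLen_ofRowLenFun _ _ _ shrinkRow_eq_zero]
      · simp only [shrinkRow, YoungDiagram.rowLen_ofRowLenFun _ _ _ (growthRow_eq_zero k),
          growthRow]
        have := hμ i; have := hν i
        omega
    · simp only [YoungDiagram.rowLen_ofRowLenFun _ _ _ (growthRow_eq_zero k), growthRow]
      omega

theorem card_growthEquiv_symm (μ ν : YoungDiagram)
    (p : {ρ // Interlaces ρ μ ∧ Interlaces ρ ν} × ℕ) :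
    ((growthEquiv μ ν).symm p).1.card + p.1.1.card = μ.card + ν.card + p.2 := by
  obtain ⟨⟨ρ, hμ, hν⟩, k⟩ := p
  set lam := ((growthEquiv μ ν).symm (⟨ρ, hμ, hν⟩, k)).1 with hlam
  have hrow : ∀ i, lam.rowLen i = growthRow μ ν ρ k i := fun i =>
    YoungDiagram.rowLen_ofRowLenFun _ (antitone_growthRow hμ hν k) _ (growthRow_eq_zero k) i
  obtain ⟨N, hN⟩ : ∃ N, N = lam.colLen 0 + ρ.colLen 0 + μ.colLen 0 + ν.colLen 0 := ⟨_, rfl⟩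
  have e1 : lam.card = ∑ i ∈ Finset.range (N + 1), lam.rowLen i :=
    YoungDiagram.card_eq_sum_rowLen (by omega)
  have e2 : ρ.card = ∑ i ∈ Finset.range N, ρ.rowLen i :=
    YoungDiagram.card_eq_sum_rowLen (by omega)
  have e3 : μ.card = ∑ i ∈ Finset.range (N + 1), μ.rowLen i :=
    YoungDiagram.card_eq_sum_rowLen (by omega)
  have e4 : ν.card = ∑ i ∈ Finset.range (N + 1), ν.rowLen i :=
    YoungDiagram.card_eq_sum_rowLen (by omega)
  have z1 : μ.rowLen N = 0 := YoungDiagram.rowLen_eq_zero (by omega)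
  have key : ∀ M, ∑ i ∈ Finset.range (M + 1), lam.rowLen i + ∑ i ∈ Finset.range M, ρ.rowLen i
      + min (μ.rowLen M) (ν.rowLen M) =
      ∑ i ∈ Finset.range (M + 1), μ.rowLen i + ∑ i ∈ Finset.range (M + 1), ν.rowLen i + k := by
    intro M
    induction M with
    | zero => simp [hrow, growthRow]; omega
    | succ M ih =>
      rw [Finset.sum_range_succ lam.rowLen (M + 1), Finset.sum_range_succ ρ.rowLen M,
        Finset.sum_range_succ μ.rowLen (M + 1), Finset.sum_range_succ ν.rowLen (M + 1),
        hrow (M + 1)]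
      have := hμ M; have := hν M
      simp only [growthRow]
      omega
  have := key N
  simp only [e1, e2, e3, e4]
  omega

/-- Semistandard tableaux of shape `lam` with all entries smaller than `n`. -/
abbrev BoundedTableau (n : ℕ) (lam : YoungDiagram) : Type :=
  {T : SemistandardYoungTableau lam // ∀ i j, (i, j) ∈ lam → T i j < n}

namespace BoundedTableau

/-- The weight of a tableau with entries smaller than `n`, as a vector indexed by `Fin n`. -/
def weight {n : ℕ} {lam : YoungDiagram} (T : BoundedTableau n lam) (j : Fin n) : ℕ :=
  ssytWeight T.1 j

/-- Extend a tableau by a horizontal strip filled with a new largest entry. -/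
def extend {n : ℕ} {μ lam : YoungDiagram} (h : Interlaces μ lam) (T : BoundedTableau n μ) :
    BoundedTableau (n + 1) lam where
  val :=
    { entry := fun i j => if (i, j) ∈ μ then T.1 i j else if (i, j) ∈ lam then n else 0
      row_weak' := by
        intro i j1 j2 hj hc
        have hc1 := lam.up_left_mem le_rfl hj.le hc
        by_cases h2 : (i, j2) ∈ μ
        · simpa [h2, μ.up_left_mem le_rfl hj.le h2] using T.1.row_weak hj h2
        · by_cases h1 : (i, j1) ∈ μ
          · simpa [h1, h2, hc] using (T.2 _ _ h1).le
          · simp [h1, h2, hc, hc1]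
      col_strict' := by
        intro i1 i2 j hi hc
        have h1 : (i1, j) ∈ μ :=
          (interlaces_iff.1 h).2 i1 j (lam.up_left_mem (Nat.succ_le_of_lt hi) le_rfl hc)
        by_cases h2 : (i2, j) ∈ μ
        · simpa [h1, h2] using T.1.col_strict hi h2
        · simpa [h1, h2, hc] using T.2 _ _ h1
      zeros' := by
        intro i j hc
        have h1 : (i, j) ∉ μ := fun h' => hc (h.le h')
        simp [h1, hc] }
  property := by
    intro i j hc
    change (if (i, j) ∈ μ then T.1 i j else if (i, j) ∈ lam then n else 0) < n + 1
    split_ifs with h1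
    · exact (T.2 _ _ h1).trans n.lt_succ_self
    · exact n.lt_succ_self

theorem extend_apply {n : ℕ} {μ lam : YoungDiagram} (h : Interlaces μ lam)
    (T : BoundedTableau n μ) (i j : ℕ) :
    (extend h T).1 i j = if (i, j) ∈ μ then T.1 i j else if (i, j) ∈ lam then n else 0 :=
  rfl

theorem mem_iff_extend_lt {n : ℕ} {μ lam : YoungDiagram} (h : Interlaces μ lam)
    (T : BoundedTableau n μ) (i j : ℕ) :
    (i, j) ∈ μ ↔ (i, j) ∈ lam ∧ (extend h T).1 i j < n := by
  rw [extend_apply]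
  constructor
  · intro h1
    simpa [h1, T.2 _ _ h1] using h.le h1
  · rintro ⟨h1, h2⟩
    by_contra h3
    simp [h1, h3] at h2

theorem weight_extend {n : ℕ} {μ lam : YoungDiagram} (h : Interlaces μ lam)
    (T : BoundedTableau n μ) :
    (extend h T).weight = Fin.snoc (α := fun _ => ℕ) T.weight (lam.card - μ.card) := by
  funext j
  refine Fin.lastCases ?_ (fun j => ?_) j
  · rw [weight, ssytWeight, Fin.snoc_last, YoungDiagram.card, YoungDiagram.card,
      ← Finset.card_sdiff_of_subset (YoungDiagram.cells_subset_iff.2 h.le)]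
    refine congrArg Finset.card ?_
    ext ⟨a, b⟩
    rw [Finset.mem_filter]
    simp only [Finset.mem_sdiff, YoungDiagram.mem_cells, extend_apply, Fin.val_last]
    refine and_congr_right fun hc => ?_
    by_cases h1 : (a, b) ∈ μ
    · simpa [h1] using (T.2 _ _ h1).ne
    · simp [h1, hc]
  · rw [weight, ssytWeight, Fin.snoc_castSucc, weight, ssytWeight]
    refine congrArg Finset.card ?_
    ext ⟨a, b⟩
    rw [Finset.mem_filter, Finset.mem_filter]
    simp only [YoungDiagram.mem_cells, extend_apply, Fin.val_castSucc]
    have := j.2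
    by_cases h1 : (a, b) ∈ μ
    · simpa [h1] using fun _ => h.le h1
    · simp only [h1, if_false, false_and, iff_false, not_and]
      intro hc
      simp only [hc, if_true]
      omega

theorem bijective_extend (n : ℕ) (lam : YoungDiagram) :
    Function.Bijective fun p : Σ μ : {μ // Interlaces μ lam}, BoundedTableau n μ.1 =>
      extend p.1.2 p.2 := by
  constructor
  · rintro ⟨⟨μ, h⟩, T⟩ ⟨⟨μ', h'⟩, T'⟩ heq
    dsimp only at heq
    obtain rfl : μ = μ' := by
      ext ⟨i, j⟩
      rw [YoungDiagram.mem_cells, YoungDiagram.mem_cells, mem_iff_extend_lt h T,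
        mem_iff_extend_lt h' T', heq]
    obtain rfl : T = T' := by
      refine Subtype.ext (SemistandardYoungTableau.ext fun i j => ?_)
      by_cases hc : (i, j) ∈ μ
      · have := congrArg (fun S : BoundedTableau (n + 1) lam => S.1 i j) heq
        simpa [extend_apply, hc] using this
      · rw [T.1.zeros hc, T'.1.zeros hc]
    rfl
  · intro T
    let μ : YoungDiagram :=
      { cells := lam.cells.filter fun c => T.1 c.1 c.2 < n
        isLowerSet := by
          rintro ⟨i, j⟩ ⟨i', j'⟩ ⟨hi, hj⟩ hc
          simp only [Finset.coe_filter, Set.mem_ofPred_eq, YoungDiagram.mem_cells] at *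
          refine ⟨lam.up_left_mem hi hj hc.1, lt_of_le_of_lt ?_ hc.2⟩
          exact (T.1.col_weak hi (lam.up_left_mem le_rfl hj hc.1)).trans
            (T.1.row_weak_of_le hj hc.1) }
    have hmem : ∀ i j, (i, j) ∈ μ ↔ (i, j) ∈ lam ∧ T.1 i j < n := fun i j => by
      rw [← YoungDiagram.mem_cells]
      simp [μ]
    have h : Interlaces μ lam := by
      refine interlaces_iff.2 ⟨fun ⟨i, j⟩ hc => ((hmem i j).1 hc).1, fun i j hc => ?_⟩
      refine (hmem i j).2 ⟨lam.up_left_mem (Nat.le_add_right i 1) le_rfl hc, ?_⟩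
      have h1 := T.1.col_strict (Nat.lt_add_one i) hc
      have h2 := T.2 _ _ hc
      omega
    let S : BoundedTableau n μ :=
      ⟨{ entry := fun i j => if (i, j) ∈ μ then T.1 i j else 0
         row_weak' := fun {i j1 j2} hj hc => by
          simpa [hc, μ.up_left_mem le_rfl hj.le hc] using T.1.row_weak hj ((hmem _ _).1 hc).1
         col_strict' := fun {i1 i2 j} hi hc => by
          simpa [hc, μ.up_left_mem hi.le le_rfl hc] using T.1.col_strict hi ((hmem _ _).1 hc).1
         zeros' := fun hc => if_neg hc }, fun i j hc => by
          change (if (i, j) ∈ μ then T.1 i j else 0) < n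
          simpa [hc] using ((hmem _ _).1 hc).2⟩
    refine ⟨⟨⟨μ, h⟩, S⟩, Subtype.ext (SemistandardYoungTableau.ext fun i j => ?_)⟩
    change (if (i, j) ∈ μ then (if (i, j) ∈ μ then T.1 i j else 0)
      else if (i, j) ∈ lam then n else 0) = T.1 i j
    by_cases hc : (i, j) ∈ lam
    · by_cases h1 : (i, j) ∈ μ
      · simp [h1]
      · have h2 := T.2 _ _ hc
        have h3 : ¬ T.1 i j < n := fun h3 => h1 ((hmem i j).2 ⟨hc, h3⟩)
        simp only [h1, hc, if_true, if_false]
        omega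
    · have h1 : (i, j) ∉ μ := fun h' => hc (h.le h')
      simp [h1, hc, T.1.zeros hc]

theorem tsum_succ {n : ℕ} (lam : YoungDiagram) (φ : (Fin (n + 1) → ℕ) → ℝ≥0∞) :
    ∑' T : BoundedTableau (n + 1) lam, φ T.weight =
      ∑' μ : {μ // Interlaces μ lam}, ∑' T : BoundedTableau n μ.1,
        φ (Fin.snoc (α := fun _ => ℕ) T.weight (lam.card - μ.1.card)) := by
  rw [← (Equiv.ofBijective _ (bijective_extend n lam)).tsum_eq, ENNReal.tsum_sigma']
  simp only [Equiv.ofBijective_apply, weight_extend]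

theorem isEmpty_zero {lam : YoungDiagram} (h : lam ≠ ⊥) : IsEmpty (BoundedTableau 0 lam) := by
  refine ⟨fun T => h ?_⟩
  ext ⟨i, j⟩
  simpa using fun hc => absurd (T.2 i j hc) (Nat.not_lt_zero _)

instance : Unique (BoundedTableau 0 ⊥) where
  default := ⟨default, fun i j hc => absurd hc (YoungDiagram.notMem_bot _)⟩
  uniq T := Subtype.ext <| SemistandardYoungTableau.ext fun i j => by
    rw [T.1.zeros (YoungDiagram.notMem_bot _),
      SemistandardYoungTableau.zeros _ (YoungDiagram.notMem_bot _)]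

end BoundedTableau

theorem snoc_add_snoc {n : ℕ} (v w : Fin n → ℕ) (x y : ℕ) :
    Fin.snoc (α := fun _ => ℕ) v x + Fin.snoc (α := fun _ => ℕ) w y =
      Fin.snoc (α := fun _ => ℕ) (v + w) (x + y) := by
  funext i
  refine Fin.lastCases ?_ (fun i => ?_) i <;> simp

theorem tsum_tsum_subtype_comm {α β : Type*} (q : α → β → Prop) (f : α → β → ℝ≥0∞) :
    ∑' x, ∑' y : {y // q x y}, f x y = ∑' y, ∑' x : {x // q x y}, f x y := by
  calc
    _ = ∑' x, ∑' y, {y | q x y}.indicator (f x) y :=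
      tsum_congr fun x => tsum_subtype {y | q x y} (f x)
    _ = ∑' y, ∑' x, {x | q x y}.indicator (fun x => f x y) x := ENNReal.tsum_comm
    _ = _ := tsum_congr fun y => (tsum_subtype {x | q x y} fun x => f x y).symm

theorem tsum_subtype_tsum_subtype_comm {α β : Type*} (p : α → Prop) (q : α → β → Prop)
    (f : α → β → ℝ≥0∞) :
    ∑' x : {x // p x}, ∑' y : {y // q x y}, f x y =
      ∑' y, ∑' x : {x // q x y ∧ p x}, f x y := by
  rw [tsum_tsum_subtype_comm (fun (x : {x // p x}) y => q x y) fun x y => f x y]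
  refine tsum_congr fun y => ?_
  let e : {x : {x // p x} // q x y} ≃ {x // q x y ∧ p x} :=
    (Equiv.subtypeSubtypeEquivSubtypeInter p fun x => q x y).trans
      (Equiv.subtypeEquivRight fun _ => and_comm)
  exact e.tsum_eq fun x => f x.1 y

/-- Local RSK rule as an identity of sums over common successors of `μ` and `ν`. -/
theorem tsum_common_successor (μ ν : YoungDiagram) (f : ℕ → ℕ → ℝ≥0∞) :
    ∑' lam : {lam // Interlaces μ lam ∧ Interlaces ν lam},
        f (lam.1.card - μ.card) (lam.1.card - ν.card) =
      ∑' (k : ℕ) (ρ : {ρ // Interlaces ρ μ ∧ Interlaces ρ ν}),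
        f (ν.card - ρ.1.card + k) (μ.card - ρ.1.card + k) := by
  rw [← (growthEquiv μ ν).symm.tsum_eq, ENNReal.tsum_prod', ENNReal.tsum_comm]
  refine tsum_congr fun k => tsum_congr fun ρ => ?_
  have h := card_growthEquiv_symm μ ν (ρ, k)
  have h1 := ρ.2.1.card_le
  have h2 := ρ.2.2.card_le
  simp only at h
  congr 1 <;> omega

theorem interlaces_bot_right {μ : YoungDiagram} : Interlaces μ ⊥ ↔ μ = ⊥ := by
  constructor
  · exact fun h => le_bot_iff.1 h.le
  · rintro rfl
    exact interlaces_iff.2 ⟨le_rfl, fun i j h => absurd h (YoungDiagram.notMem_bot _)⟩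

/-- Summing over the tableaux whose shape is obtained from `ν` by adding a horizontal strip amounts
to summing over tableaux of shape `ν` and vectors to be added to the weight. -/
theorem tsum_tableau_successor (n : ℕ) (ν : YoungDiagram) (φ : ℕ → (Fin n → ℕ) → ℝ≥0∞) :
    ∑' lam : {lam // Interlaces ν lam}, ∑' T : BoundedTableau n lam.1,
        φ (lam.1.card - ν.card) T.weight =
      ∑' (a : Fin n → ℕ) (T : BoundedTableau n ν), φ (∑ i, a i) (T.weight + a) := by
  induction n generalizing ν with
  | zero =>
    rw [tsum_eq_single (f := fun a : Fin 0 → ℕ => ∑' T : BoundedTableau 0 ν,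
      φ (∑ i, a i) (T.weight + a)) 0 fun a ha => absurd (Subsingleton.elim a 0) ha]
    by_cases hν : ν = ⊥
    · subst hν
      rw [tsum_eq_single ⟨⊥, interlaces_bot_right.2 rfl⟩]
      · simp [Subsingleton.elim ![] (default : BoundedTableau 0 ⊥).weight]
      · rintro ⟨lam, h⟩ hne
        have := BoundedTableau.isEmpty_zero (lam := lam) fun h' => hne (Subtype.ext h')
        exact tsum_empty
    · have := BoundedTableau.isEmpty_zero hν
      rw [tsum_empty (β := BoundedTableau 0 ν), ENNReal.tsum_eq_zero]
      rintro ⟨lam, h⟩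
      have := BoundedTableau.isEmpty_zero (lam := lam) fun h' =>
        hν (interlaces_bot_right.1 (h' ▸ h))
      exact tsum_empty
  | succ n ih =>
    calc
      _ = ∑' lam : {lam // Interlaces ν lam}, ∑' μ : {μ // Interlaces μ lam.1},
            ∑' T : BoundedTableau n μ.1, φ (lam.1.card - ν.card)
              (Fin.snoc (α := fun _ => ℕ) T.weight (lam.1.card - μ.1.card)) :=
        tsum_congr fun lam => BoundedTableau.tsum_succ lam.1 (φ (lam.1.card - ν.card))
      _ = ∑' μ : YoungDiagram, ∑' lam : {lam // Interlaces μ lam ∧ Interlaces ν lam},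
            ∑' T : BoundedTableau n μ, φ (lam.1.card - ν.card)
              (Fin.snoc (α := fun _ => ℕ) T.weight (lam.1.card - μ.card)) :=
        tsum_subtype_tsum_subtype_comm (Interlaces ν) (fun lam μ => Interlaces μ lam)
          fun lam μ => ∑' T : BoundedTableau n μ, φ (lam.card - ν.card)
            (Fin.snoc (α := fun _ => ℕ) T.weight (lam.card - μ.card))
      _ = ∑' (μ : YoungDiagram) (k : ℕ) (ρ : {ρ // Interlaces ρ μ ∧ Interlaces ρ ν}),
            ∑' T : BoundedTableau n μ, φ (μ.card - ρ.1.card + k)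
              (Fin.snoc (α := fun _ => ℕ) T.weight (ν.card - ρ.1.card + k)) :=
        tsum_congr fun μ => tsum_common_successor μ ν fun x y =>
          ∑' T : BoundedTableau n μ, φ y (Fin.snoc (α := fun _ => ℕ) T.weight x)
      _ = ∑' (k : ℕ) (μ : YoungDiagram) (ρ : {ρ // Interlaces ρ μ ∧ Interlaces ρ ν}),
            ∑' T : BoundedTableau n μ, φ (μ.card - ρ.1.card + k)
              (Fin.snoc (α := fun _ => ℕ) T.weight (ν.card - ρ.1.card + k)) := ENNReal.tsum_comm
      _ = ∑' (k : ℕ) (ρ : {ρ // Interlaces ρ ν}) (μ : {μ // Interlaces ρ.1 μ}),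
            ∑' T : BoundedTableau n μ.1, φ (μ.1.card - ρ.1.card + k)
              (Fin.snoc (α := fun _ => ℕ) T.weight (ν.card - ρ.1.card + k)) :=
        tsum_congr fun k => (tsum_subtype_tsum_subtype_comm (fun ρ => Interlaces ρ ν)
          (fun ρ μ => Interlaces ρ μ) fun ρ μ => ∑' T : BoundedTableau n μ,
            φ (μ.card - ρ.card + k)
              (Fin.snoc (α := fun _ => ℕ) T.weight (ν.card - ρ.card + k))).symm
      _ = ∑' (k : ℕ) (ρ : {ρ // Interlaces ρ ν}) (a : Fin n → ℕ) (T : BoundedTableau n ρ.1),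
            φ (∑ i, a i + k)
              (Fin.snoc (α := fun _ => ℕ) (T.weight + a) (ν.card - ρ.1.card + k)) :=
        tsum_congr fun k => tsum_congr fun ρ => ih ρ.1 fun x w =>
          φ (x + k) (Fin.snoc (α := fun _ => ℕ) w (ν.card - ρ.1.card + k))
      _ = ∑' (k : ℕ) (a : Fin n → ℕ) (ρ : {ρ // Interlaces ρ ν}) (T : BoundedTableau n ρ.1),
            φ (∑ i, a i + k)
              (Fin.snoc (α := fun _ => ℕ) (T.weight + a) (ν.card - ρ.1.card + k)) :=
        tsum_congr fun k => ENNReal.tsum_comm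
      _ = ∑' (k : ℕ) (a : Fin n → ℕ) (T : BoundedTableau (n + 1) ν),
            φ (∑ i, a i + k) (T.weight + Fin.snoc (α := fun _ => ℕ) a k) := by
        refine tsum_congr fun k => tsum_congr fun a => ?_
        rw [BoundedTableau.tsum_succ ν fun w =>
          φ (∑ i, a i + k) (w + Fin.snoc (α := fun _ => ℕ) a k)]
        simp only [snoc_add_snoc]
      _ = _ := by
        rw [← (Fin.snocEquiv fun _ : Fin (n + 1) => ℕ).tsum_eq, ENNReal.tsum_prod']
        refine tsum_congr fun k => tsum_congr fun a => ?_
        simp [Fin.snocEquiv, Fin.sum_univ_castSucc]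

/-- Symmetric `n × n` matrices of natural numbers. -/
abbrev SymmMatrix (n : ℕ) : Type :=
  {A : Matrix (Fin n) (Fin n) ℕ // A.IsSymm}

namespace SymmMatrix

/-- The vector of row sums. -/
def rowSum {n : ℕ} (A : SymmMatrix n) (i : Fin n) : ℕ :=
  ∑ j, A.1 i j

/-- Splitting off the last row and column of a symmetric matrix. -/
def snocEquiv (n : ℕ) : ℕ × (Fin n → ℕ) × SymmMatrix n ≃ SymmMatrix (n + 1) where
  toFun p :=
    ⟨Fin.snoc (α := fun _ => Fin (n + 1) → ℕ)
        (fun i => Fin.snoc (α := fun _ => ℕ) (p.2.2.1 i) (p.2.1 i))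
        (Fin.snoc (α := fun _ => ℕ) p.2.1 p.1), by
      refine Matrix.IsSymm.ext fun i j => ?_
      refine Fin.lastCases ?_ (fun i => ?_) i <;> refine Fin.lastCases ?_ (fun j => ?_) j <;>
        simp [p.2.2.2.apply]⟩
  invFun A :=
    (A.1 (Fin.last n) (Fin.last n), fun i => A.1 (Fin.last n) i.castSucc,
      ⟨A.1.submatrix Fin.castSucc Fin.castSucc, A.2.submatrix _⟩)
  left_inv := by
    rintro ⟨k, a, A, hA⟩
    refine Prod.ext (by simp) (Prod.ext (by ext; simp) (Subtype.ext ?_))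
    ext i j
    simp [Matrix.submatrix]
  right_inv := by
    rintro ⟨A, hA⟩
    refine Subtype.ext ?_
    ext i j
    refine Fin.lastCases ?_ (fun i => ?_) i <;> refine Fin.lastCases ?_ (fun j => ?_) j <;>
      simp [hA.apply]

theorem rowSum_snocEquiv {n : ℕ} (k : ℕ) (a : Fin n → ℕ) (A : SymmMatrix n) :
    (snocEquiv n (k, a, A)).rowSum =
      Fin.snoc (α := fun _ => ℕ) (A.rowSum + a) (∑ i, a i + k) := by
  funext i
  refine Fin.lastCases ?_ (fun i => ?_) i <;> simp [rowSum, snocEquiv, Fin.sum_univ_castSucc]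

end SymmMatrix

/-- Symmetric matrices and tableaux have the same distribution of weights. -/
theorem tsum_tableau_eq_tsum_symmMatrix (n : ℕ) (φ : (Fin n → ℕ) → ℝ≥0∞) :
    ∑' (lam : YoungDiagram) (T : BoundedTableau n lam), φ T.weight =
      ∑' A : SymmMatrix n, φ A.rowSum := by
  induction n with
  | zero =>
    rw [tsum_eq_single ⊥, tsum_eq_single default fun T hT => absurd (Subsingleton.elim T _) hT,
      tsum_eq_single ⟨0, Matrix.isSymm_zero⟩ fun A hA => absurd (Subsingleton.elim A _) hA]
    · exact congrArg φ (Subsingleton.elim _ _)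
    · intro lam h
      have := BoundedTableau.isEmpty_zero h
      exact tsum_empty
  | succ n ih =>
    calc
      _ = ∑' (lam : YoungDiagram) (μ : {μ // Interlaces μ lam}) (T : BoundedTableau n μ.1),
            φ (Fin.snoc (α := fun _ => ℕ) T.weight (lam.card - μ.1.card)) :=
        tsum_congr fun lam => BoundedTableau.tsum_succ lam φ
      _ = ∑' (μ : YoungDiagram) (lam : {lam // Interlaces μ lam}) (T : BoundedTableau n μ),
            φ (Fin.snoc (α := fun _ => ℕ) T.weight (lam.1.card - μ.card)) :=
        tsum_tsum_subtype_comm (fun lam μ => Interlaces μ lam) fun lam μ =>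
          ∑' T : BoundedTableau n μ,
            φ (Fin.snoc (α := fun _ => ℕ) T.weight (lam.card - μ.card))
      _ = ∑' (μ : YoungDiagram) (k : ℕ) (ρ : {ρ // Interlaces ρ μ}) (T : BoundedTableau n μ),
            φ (Fin.snoc (α := fun _ => ℕ) T.weight (μ.card - ρ.1.card + k)) := by
        refine tsum_congr fun μ => ?_
        have h := tsum_common_successor μ μ fun x _ =>
          ∑' T : BoundedTableau n μ, φ (Fin.snoc (α := fun _ => ℕ) T.weight x)
        calc
          _ = _ := ((Equiv.subtypeEquivRight fun _ => and_self_iff).tsum_eq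
            fun lam : {lam // Interlaces μ lam} => ∑' T : BoundedTableau n μ,
              φ (Fin.snoc (α := fun _ => ℕ) T.weight (lam.1.card - μ.card))).symm
          _ = _ := h
          _ = _ := tsum_congr fun k => (Equiv.subtypeEquivRight fun _ => and_self_iff).tsum_eq
            fun ρ : {ρ // Interlaces ρ μ} => ∑' T : BoundedTableau n μ,
              φ (Fin.snoc (α := fun _ => ℕ) T.weight (μ.card - ρ.1.card + k))
      _ = ∑' (k : ℕ) (μ : YoungDiagram) (ρ : {ρ // Interlaces ρ μ}) (T : BoundedTableau n μ),
            φ (Fin.snoc (α := fun _ => ℕ) T.weight (μ.card - ρ.1.card + k)) := ENNReal.tsum_comm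
      _ = ∑' (k : ℕ) (ρ : YoungDiagram) (μ : {μ // Interlaces ρ μ}) (T : BoundedTableau n μ.1),
            φ (Fin.snoc (α := fun _ => ℕ) T.weight (μ.1.card - ρ.card + k)) :=
        tsum_congr fun k => tsum_tsum_subtype_comm (fun μ ρ => Interlaces ρ μ) fun μ ρ =>
          ∑' T : BoundedTableau n μ,
            φ (Fin.snoc (α := fun _ => ℕ) T.weight (μ.card - ρ.card + k))
      _ = ∑' (k : ℕ) (ρ : YoungDiagram) (a : Fin n → ℕ) (T : BoundedTableau n ρ),
            φ (Fin.snoc (α := fun _ => ℕ) (T.weight + a) (∑ i, a i + k)) :=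
        tsum_congr fun k => tsum_congr fun ρ => tsum_tableau_successor n ρ fun x w =>
          φ (Fin.snoc (α := fun _ => ℕ) w (x + k))
      _ = ∑' (k : ℕ) (a : Fin n → ℕ) (ρ : YoungDiagram) (T : BoundedTableau n ρ),
            φ (Fin.snoc (α := fun _ => ℕ) (T.weight + a) (∑ i, a i + k)) :=
        tsum_congr fun k => ENNReal.tsum_comm
      _ = ∑' (k : ℕ) (a : Fin n → ℕ) (A : SymmMatrix n),
            φ (Fin.snoc (α := fun _ => ℕ) (A.rowSum + a) (∑ i, a i + k)) :=
        tsum_congr fun k => tsum_congr fun a => ih fun w =>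
          φ (Fin.snoc (α := fun _ => ℕ) (w + a) (∑ i, a i + k))
      _ = _ := by
        rw [← (SymmMatrix.snocEquiv n).tsum_eq, ENNReal.tsum_prod']
        refine tsum_congr fun k => ?_
        rw [ENNReal.tsum_prod']
        simp only [SymmMatrix.rowSum_snocEquiv]

theorem tsum_indicator_eq_encard {α : Type*} (s : Set α) :
    ∑' x, s.indicator (fun _ => (1 : ℝ≥0∞)) x = s.encard := by
  rw [← tsum_subtype, ENNReal.tsum_set_one]

theorem BoundedTableau.weight_eq_iff {n : ℕ} {lam : YoungDiagram} (T : BoundedTableau n lam)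
    (ν : Fin n → ℕ) :
    T.weight = ν ↔ ∀ j : ℕ, ssytWeight T.1 j = if h : j < n then ν ⟨j, h⟩ else 0 := by
  refine ⟨fun h j => ?_, fun h => funext fun j => by simpa [BoundedTableau.weight] using h j⟩
  split_ifs with hj
  · exact congrFun h ⟨j, hj⟩
  · refine Finset.card_eq_zero.2 (Finset.filter_eq_empty_iff.2 ?_)
    rintro ⟨a, b⟩ hc rfl
    exact hj (T.2 a b ((YoungDiagram.mem_cells _).1 hc))

theorem lt_of_ssytWeight {n : ℕ} {lam : YoungDiagram} {ν : Fin n → ℕ}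
    {T : SemistandardYoungTableau lam}
    (hT : ∀ j : ℕ, ssytWeight T j = if h : j < n then ν ⟨j, h⟩ else 0) {i j : ℕ}
    (hc : (i, j) ∈ lam) : T i j < n := by
  by_contra hlt
  have h := hT (T i j)
  rw [dif_neg hlt, ssytWeight, Finset.card_eq_zero, Finset.filter_eq_empty_iff] at h
  exact h ((YoungDiagram.mem_cells (i, j)).2 hc) rfl

theorem encard_weight_eq {n : ℕ} (lam : YoungDiagram) (ν : Fin n → ℕ) :
    {T : BoundedTableau n lam | T.weight = ν}.encard =
      {T : SemistandardYoungTableau lam |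
        ∀ j : ℕ, ssytWeight T j = if h : j < n then ν ⟨j, h⟩ else 0}.encard := by
  rw [← (Subtype.val_injective (p := fun T : SemistandardYoungTableau lam =>
    ∀ i j, (i, j) ∈ lam → T i j < n)).encard_image]
  congr 1
  ext T
  constructor
  · rintro ⟨T, hT, rfl⟩
    exact (BoundedTableau.weight_eq_iff T ν).1 hT
  · intro hT
    exact ⟨⟨T, fun i j => lt_of_ssytWeight hT⟩, (BoundedTableau.weight_eq_iff _ ν).2 hT, rfl⟩

theorem card_eq_of_ssytWeight {n : ℕ} {lam : YoungDiagram} {ν : Fin n → ℕ}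
    {T : SemistandardYoungTableau lam}
    (hT : ∀ j : ℕ, ssytWeight T j = if h : j < n then ν ⟨j, h⟩ else 0) :
    lam.card = ∑ j, ν j := by
  rw [YoungDiagram.card, Finset.card_eq_sum_card_fiberwise (f := fun c => T c.1 c.2)
    (t := Finset.range n), Finset.sum_range]
  · refine Finset.sum_congr rfl fun j _ => ?_
    have := hT j
    rw [dif_pos j.2] at this
    exact this
  · rintro ⟨i, j⟩ hc
    simpa using lt_of_ssytWeight hT ((YoungDiagram.mem_cells _).1 hc)

theorem finite_symm_rowSum {n : ℕ} (ν : Fin n → ℕ) :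
    {A : Matrix (Fin n) (Fin n) ℕ | A.IsSymm ∧ ∀ i, ∑ j, A i j = ν i}.Finite := by
  have h : (Set.univ.pi fun i : Fin n => Set.univ.pi fun _ : Fin n => Set.Iic (ν i)).Finite :=
    Set.Finite.pi fun i => Set.Finite.pi fun _ => Set.finite_Iic _
  refine h.subset fun A hA i _ j _ => ?_
  rw [Set.mem_Iic, ← hA.2 i]
  exact Finset.single_le_sum (f := fun j => A i j) (fun _ _ => Nat.zero_le _) (Finset.mem_univ j)

theorem encard_symm_rowSum {n : ℕ} (ν : Fin n → ℕ) :
    {A : SymmMatrix n | A.rowSum = ν}.encard =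
      {A : Matrix (Fin n) (Fin n) ℕ | A.IsSymm ∧ ∀ i, ∑ j, A i j = ν i}.encard := by
  rw [← (Subtype.val_injective (p := fun A : Matrix (Fin n) (Fin n) ℕ => A.IsSymm)).encard_image]
  congr 1
  ext A
  constructor
  · rintro ⟨A, hA, rfl⟩
    exact ⟨A.2, congrFun hA⟩
  · rintro ⟨hA, h⟩
    exact ⟨⟨A, hA⟩, funext h, rfl⟩

theorem tsum_encard_eq {n : ℕ} (ν : Fin n → ℕ) :
    ∑' lam : YoungDiagram, ({T : SemistandardYoungTableau lam |
        ∀ j : ℕ, ssytWeight T j = if h : j < n then ν ⟨j, h⟩ else 0}.encard : ℝ≥0∞) =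
      ({A : Matrix (Fin n) (Fin n) ℕ | A.IsSymm ∧ ∀ i, ∑ j, A i j = ν i}.encard : ℝ≥0∞) := by
  rw [← encard_symm_rowSum, ← tsum_indicator_eq_encard]
  simp_rw [← encard_weight_eq, ← tsum_indicator_eq_encard]
  exact tsum_tableau_eq_tsum_symmMatrix n (({ν} : Set (Fin n → ℕ)).indicator fun _ => 1)

theorem tsum_tabCard {n : ℕ} (ν : Fin n → ℕ) :
    ∑' lam : YoungDiagram, (tabCard lam ν : ℝ≥0∞) =
      ({A : Matrix (Fin n) (Fin n) ℕ | A.IsSymm ∧ ∀ i, ∑ j, A i j = ν i}.ncard : ℝ≥0∞) := by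
  have h := tsum_encard_eq ν
  rw [← (finite_symm_rowSum ν).cast_ncard_eq, ENat.toENNReal_coe] at h
  rw [← h]
  refine tsum_congr fun lam => ?_
  have hlt := ENNReal.ne_top_of_tsum_ne_top (h.trans_ne (ENNReal.natCast_ne_top _)) lam
  rw [ENat.toENNReal_ne_top, Set.encard_ne_top_iff] at hlt
  rw [← hlt.cast_ncard_eq, ENat.toENNReal_coe, tabCard]

/-- **Symmetry of RSK, enumerative form.** The number of symmetric `n × n` matrices of
nonnegative integers with row sums `ν` (summing to `d`) equals `∑_{λ ⊢ d} |Tab(λ,ν)|`. -/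
theorem rsk_symmetric_card (n d : ℕ) (ν : Fin n → ℕ) (hν : ∑ j, ν j = d) :
    Set.ncard {A : Matrix (Fin n) (Fin n) ℕ |
        A.IsSymm ∧ (∀ i, ∑ j, A i j = ν i)} =
      ∑ᶠ (lam : YoungDiagram) (_ : lam.card = d), tabCard lam ν := by
  have hsum := tsum_tabCard ν
  have hfin : (Function.support fun lam : YoungDiagram => (tabCard lam ν : ℝ≥0∞)).Finite := by
    refine (ENNReal.finite_const_le_of_tsum_ne_top
      (hsum.trans_ne (ENNReal.natCast_ne_top _)) one_ne_zero).subset fun lam h => ?_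
    simp only [Function.mem_support, ne_eq, Nat.cast_eq_zero] at h
    exact_mod_cast Nat.one_le_iff_ne_zero.2 h
  have hfin' : (Function.support fun lam : YoungDiagram => tabCard lam ν).Finite := by
    simpa [Function.support] using hfin
  have hcard : ∀ lam : YoungDiagram,
      ∑ᶠ _ : lam.card = d, tabCard lam ν = tabCard lam ν := fun lam => by
    by_cases h : lam.card = d
    · rw [finsum_eq_if, if_pos h]
    · rw [finsum_eq_if, if_neg h, tabCard, eq_comm]
      convert Set.ncard_empty (SemistandardYoungTableau lam)
      exact Set.eq_empty_iff_forall_notMem.2 fun T hT => h ((card_eq_of_ssytWeight hT).trans hν)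
  simp_rw [hcard]
  rw [tsum_eq_finsum hfin] at hsum
  have hcast := (Nat.castAddMonoidHom ℝ≥0∞).map_finsum hfin'
  simp only [Nat.coe_castAddMonoidHom] at hcast
  exact_mod_cast (hcast.trans hsum).symm
end
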